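/- arXiv:1012.2856 — 2 statements merged into one kernel-verified Lean document; each statement's English description precedes it below -/
import Mathlib

section
/- Let D and C be the N×N matrices with rows indexed by θ ∈ θ_p and columns by θ' ∈ θ_a given by D_{θ,θ'} = e^{−i(l−1/2)(θ−θ')}/(2iN·sin((θ'−θ)/2)) · (√(b_{θ'})/√(b_θ) + √(b_θ)/√(b_{θ'})) and C_{θ,θ'} = e^{−i(l−1/2)(θ+θ')}/(2iN·sin((θ+θ')/2)) · (√(b_θ)√(b_{θ'}) − 1/(√(b_θ)√(b_{θ'}))). Then D is invertible and, for θ, θ' ∈ θ_a, (D^{−1}·C)_{θ,θ'} = −i·e^{−i(l−1/2)(θ+θ')} · (sinh 2K_y/sinh 2K_x) · e^{(ν_θ+ν_{θ'})/2} / (N·√(sinh γ_θ · sinh γ_{θ'})) · sin((θ−θ')/2)/sinh((γ_θ+γ_{θ'})/2). -/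
open Finset

noncomputable section

/-- Antiperiodic momenta: θ_a = {(2j−1)π/N : j = 1,…,N}. -/
def thetaA (N : ℕ) (j : Fin N) : ℝ := (2 * (j : ℝ) + 1) * Real.pi / N

/-- Periodic momenta: θ_p = {2(j−1)π/N : j = 1,…,N}. -/
def thetaP (N : ℕ) (j : Fin N) : ℝ := (2 * (j : ℝ)) * Real.pi / N

/-- b_θ, the principal square root of
`(1−αe^{iθ})(1−βe^{−iθ}) / ((1−βe^{iθ})(1−αe^{−iθ}))`. -/
def bfun (α β θ : ℝ) : ℂ :=
  ((((1 : ℂ) - (α : ℂ) * Complex.exp (Complex.I * θ)) *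
      ((1 : ℂ) - (β : ℂ) * Complex.exp (-Complex.I * θ))) /
    (((1 : ℂ) - (β : ℂ) * Complex.exp (Complex.I * θ)) *
      ((1 : ℂ) - (α : ℂ) * Complex.exp (-Complex.I * θ)))) ^ ((2 : ℂ)⁻¹)

/-- √(b_θ), principal square root. -/
def sqb (α β θ : ℝ) : ℂ := bfun α β θ ^ ((2 : ℂ)⁻¹)

/-- The matrix D, rows indexed by θ ∈ θ_p, columns by θ' ∈ θ_a. -/
def Dmat (N : ℕ) (l : ℤ) (α β : ℝ) : Matrix (Fin N) (Fin N) ℂ :=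
  Matrix.of fun j k =>
    Complex.exp (-Complex.I * ((l : ℂ) - 2⁻¹) * ((thetaP N j : ℝ) - (thetaA N k : ℝ))) /
        (2 * Complex.I * N * Complex.sin ((((thetaA N k : ℝ) : ℂ) - (thetaP N j : ℝ)) / 2)) *
      (sqb α β (thetaA N k) / sqb α β (thetaP N j) +
        sqb α β (thetaP N j) / sqb α β (thetaA N k))

/-- The matrix C, rows indexed by θ ∈ θ_p, columns by θ' ∈ θ_a. -/
def Cmat (N : ℕ) (l : ℤ) (α β : ℝ) : Matrix (Fin N) (Fin N) ℂ :=
  Matrix.of fun j k =>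
    Complex.exp (-Complex.I * ((l : ℂ) - 2⁻¹) * ((thetaP N j : ℝ) + (thetaA N k : ℝ))) /
        (2 * Complex.I * N * Complex.sin ((((thetaP N j : ℝ) : ℂ) + (thetaA N k : ℝ)) / 2)) *
      (sqb α β (thetaP N j) * sqb α β (thetaA N k) -
        1 / (sqb α β (thetaP N j) * sqb α β (thetaA N k)))

/-- ν_θ = ln [∏_{θ'∈θ_a} sinh((γ_θ+γ_{θ'})/2) / ∏_{θ'∈θ_p} sinh((γ_θ+γ_{θ'})/2)]. -/
def nufun (N : ℕ) (γ : ℝ → ℝ) (θ : ℝ) : ℝ :=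
  Real.log ((∏ j : Fin N, Real.sinh ((γ θ + γ (thetaA N j)) / 2)) /
    (∏ j : Fin N, Real.sinh ((γ θ + γ (thetaP N j)) / 2)))

/-- `γ` is the nonnegative solution of the dispersion relation with parameters `0 < X < Y`. -/
structure IsDispersion (X Y : ℝ) (γ : ℝ → ℝ) : Prop where
  pos : 0 < X
  lt : X < Y
  nonneg : ∀ θ, 0 ≤ γ θ
  cosh_eq : ∀ θ, Real.cosh (γ θ) =
    Real.cosh X * Real.cosh Y - Real.sinh X * Real.sinh Y * Real.cos θ

/-- The Laurent polynomial in `e^{iθ}` with `b_θ = symb X Y θ / sinh γ_θ`. -/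
def symb (X Y θ : ℝ) : ℂ :=
  ((Real.cosh X * Real.sinh Y - Real.sinh X * Real.cosh Y * Real.cos θ : ℝ) : ℂ)
    - Complex.I * ((Real.sinh X * Real.sin θ : ℝ) : ℂ)

namespace IsDispersion

variable {X Y : ℝ} {γ : ℝ → ℝ}

theorem pos_right (h : IsDispersion X Y γ) : 0 < Y := h.pos.trans h.lt

theorem sinh_left_pos (h : IsDispersion X Y γ) : 0 < Real.sinh X := Real.sinh_pos_iff.2 h.pos

theorem sinh_right_pos (h : IsDispersion X Y γ) : 0 < Real.sinh Y :=
  Real.sinh_pos_iff.2 h.pos_right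

theorem one_lt_cosh (h : IsDispersion X Y γ) (θ : ℝ) : 1 < Real.cosh (γ θ) := by
  have h1 : 1 < Real.cosh (Y - X) := Real.one_lt_cosh.2 (sub_pos.2 h.lt).ne'
  rw [Real.cosh_sub] at h1
  rw [h.cosh_eq]
  nlinarith [Real.cos_le_one θ, mul_pos h.sinh_left_pos h.sinh_right_pos]

theorem apply_pos (h : IsDispersion X Y γ) (θ : ℝ) : 0 < γ θ :=
  (h.nonneg θ).lt_of_ne' (Real.one_lt_cosh.1 (h.one_lt_cosh θ))

theorem sinh_pos (h : IsDispersion X Y γ) (θ : ℝ) : 0 < Real.sinh (γ θ) :=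
  Real.sinh_pos_iff.2 (h.apply_pos θ)

theorem eq_of_cosh_eq (h : IsDispersion X Y γ) {θ a : ℝ} (ha : 0 ≤ a)
    (hc : Real.cosh (γ θ) = Real.cosh a) : γ θ = a := by
  rw [← Real.arcosh_cosh (h.nonneg θ), hc, Real.arcosh_cosh ha]

theorem congr (h : IsDispersion X Y γ) {θ φ : ℝ} (hc : Real.cos θ = Real.cos φ) : γ θ = γ φ :=
  h.eq_of_cosh_eq (h.nonneg φ) (by rw [h.cosh_eq, h.cosh_eq, hc])

theorem neg (h : IsDispersion X Y γ) (θ : ℝ) : γ (-θ) = γ θ := h.congr (Real.cos_neg θ)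

theorem apply_zero (h : IsDispersion X Y γ) : γ 0 = Y - X :=
  h.eq_of_cosh_eq (sub_pos.2 h.lt).le (by rw [h.cosh_eq, Real.cosh_sub, Real.cos_zero]; ring)

theorem apply_pi (h : IsDispersion X Y γ) : γ Real.pi = Y + X :=
  h.eq_of_cosh_eq (add_pos h.pos_right h.pos).le
    (by rw [h.cosh_eq, Real.cosh_add, Real.cos_pi]; ring)

theorem continuous (h : IsDispersion X Y γ) : Continuous γ := by
  have : γ = fun θ => Real.arcosh
      (Real.cosh X * Real.cosh Y - Real.sinh X * Real.sinh Y * Real.cos θ) := by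
    funext θ
    rw [← h.cosh_eq, Real.arcosh_cosh (h.nonneg θ)]
  rw [this]
  refine Real.continuousOn_arcosh.comp_continuous (by fun_prop) fun θ => ?_
  rw [← h.cosh_eq]
  exact Real.one_le_cosh _

theorem cosh_sub_cosh (h : IsDispersion X Y γ) (θ φ : ℝ) :
    Real.cosh (γ θ) - Real.cosh (γ φ) =
      Real.sinh X * Real.sinh Y * (Real.cos φ - Real.cos θ) := by
  rw [h.cosh_eq, h.cosh_eq]; ring

end IsDispersion

theorem four_sinh_mul_sinh (u v : ℝ) :
    4 * (Real.sinh ((u + v) / 2) * Real.sinh ((u - v) / 2)) =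
      2 * (Real.cosh u - Real.cosh v) := by
  have e1 : u = (u + v) / 2 + (u - v) / 2 := by ring
  have e2 : v = (u + v) / 2 - (u - v) / 2 := by ring
  conv_rhs => rw [e1, e2, Real.cosh_add, Real.cosh_sub]
  ring_nf

theorem IsDispersion.two_sinh_mul_two_sinh {X Y : ℝ} {γ : ℝ → ℝ} (h : IsDispersion X Y γ)
    (θ φ : ℝ) :
    2 * Real.sinh ((γ θ + γ φ) / 2) * (2 * Real.sinh ((γ θ - γ φ) / 2)) =
      Real.sinh X * Real.sinh Y * (2 * Real.cos φ - 2 * Real.cos θ) := by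
  have := four_sinh_mul_sinh (γ θ) (γ φ)
  rw [h.cosh_sub_cosh] at this
  linarith

theorem symb_mul_symb_neg (X Y θ : ℝ) :
    symb X Y θ * symb X Y (-θ) =
      (((Real.cosh X * Real.cosh Y - Real.sinh X * Real.sinh Y * Real.cos θ) ^ 2 - 1 : ℝ) : ℂ) := by
  have key : (Real.cosh X * Real.cosh Y - Real.sinh X * Real.sinh Y * Real.cos θ) ^ 2 - 1 =
      (Real.cosh X * Real.sinh Y - Real.sinh X * Real.cosh Y * Real.cos θ) ^ 2 +
        (Real.sinh X * Real.sin θ) ^ 2 := by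
    linear_combination (Real.cosh X ^ 2 - Real.sinh X ^ 2 * Real.cos θ ^ 2) * Real.cosh_sq Y +
      Real.cosh_sq X - Real.sinh X ^ 2 * Real.sin_sq_add_cos_sq θ
  rw [key]
  simp only [symb, Real.cos_neg, Real.sin_neg]
  generalize Real.cosh X * Real.sinh Y - Real.sinh X * Real.cosh Y * Real.cos θ = a
  generalize Real.sin θ = b
  generalize Real.sinh X = d
  push_cast
  linear_combination (-(d : ℂ) ^ 2 * b ^ 2) * Complex.I_sq

theorem IsDispersion.symb_mul_symb_neg {X Y : ℝ} {γ : ℝ → ℝ} (h : IsDispersion X Y γ) (θ : ℝ) :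
    symb X Y θ * symb X Y (-θ) = ((Real.sinh (γ θ) : ℝ) : ℂ) ^ 2 := by
  rw [_root_.symb_mul_symb_neg, ← h.cosh_eq, ← Complex.ofReal_pow, Real.sinh_sq]

theorem symb_re_pos {X Y : ℝ} (hX : 0 < X) (hXY : X < Y) (θ : ℝ) : 0 < (symb X Y θ).re := by
  have h1 : 0 < Real.sinh (Y - X) := Real.sinh_pos_iff.2 (sub_pos.2 hXY)
  rw [Real.sinh_sub] at h1
  have h2 := Real.sinh_pos_iff.2 hX
  have h3 := Real.cosh_pos Y
  simp only [symb, Complex.sub_re, Complex.ofReal_re, Complex.mul_re, Complex.I_re,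
    Complex.I_im, Complex.ofReal_im]
  nlinarith [Real.cos_le_one θ, mul_pos h2 h3]

/-- `h` is the square root, with positive real part, of `symb X Y θ / sinh γ_θ`. -/
structure IsSymbRoot (X Y : ℝ) (γ : ℝ → ℝ) (h : ℝ → ℂ) : Prop where
  sq_mul : ∀ θ, h θ ^ 2 * Real.sinh (γ θ) = symb X Y θ
  re_pos : ∀ θ, 0 < (h θ).re

theorem star_symb (X Y θ : ℝ) : (starRingEnd ℂ) (symb X Y θ) = symb X Y (-θ) := by
  simp only [symb, map_sub, map_mul, Complex.conj_ofReal, Complex.conj_I, Real.cos_neg,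
    Real.sin_neg]
  push_cast
  ring

theorem Complex.eq_of_sq_eq_sq_of_re_pos {a b : ℂ} (ha : 0 < a.re) (hb : 0 < b.re)
    (h : a ^ 2 = b ^ 2) : a = b := by
  rw [← Complex.sq_cpow_two_inv ha, h, Complex.sq_cpow_two_inv hb]

theorem Complex.cpow_two_inv_re_pos {a : ℂ} (ha : 0 < a.re) : 0 < (a ^ (2⁻¹ : ℂ)).re := by
  have h0 : a ≠ 0 := by rintro rfl; simp at ha
  rw [Complex.cpow_def_of_ne_zero h0, Complex.exp_re]
  refine mul_pos (Real.exp_pos _) (Real.cos_pos_of_mem_Ioo ?_)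
  have h1 := abs_lt.1 (Complex.abs_arg_lt_pi_div_two_iff.2 (Or.inl ha))
  have h2 : (Complex.log a * 2⁻¹).im = a.arg / 2 := by
    have : (2⁻¹ : ℂ) = ((2⁻¹ : ℝ) : ℂ) := by simp
    rw [this, Complex.im_mul_ofReal, Complex.log_im]; ring
  rw [h2]
  constructor <;> linarith [Real.pi_pos]

namespace IsSymbRoot

variable {X Y : ℝ} {γ : ℝ → ℝ} {h : ℝ → ℂ}

theorem ne_zero (hh : IsSymbRoot X Y γ h) (θ : ℝ) : h θ ≠ 0 := by
  intro h0
  simpa [h0] using hh.re_pos θ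

theorem normSq_eq_one (hh : IsSymbRoot X Y γ h) (hγ : IsDispersion X Y γ) (θ : ℝ) :
    Complex.normSq (h θ) = 1 := by
  have h1 := hγ.symb_mul_symb_neg θ
  rw [← star_symb, Complex.mul_conj, ← hh.sq_mul, Complex.normSq_mul, map_pow,
    Complex.normSq_ofReal] at h1
  have hs := hγ.sinh_pos θ
  have h2 : Complex.normSq (h θ) ^ 2 = 1 := by
    have : Complex.normSq (h θ) ^ 2 * (Real.sinh (γ θ) * Real.sinh (γ θ)) =
      Real.sinh (γ θ) ^ 2 := by exact_mod_cast h1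
    have h3 : Real.sinh (γ θ) ^ 2 ≠ 0 := by positivity
    apply mul_right_cancel₀ h3
    linarith
  exact (pow_eq_one_iff_of_nonneg (Complex.normSq_nonneg _) two_ne_zero).1 h2

theorem mul_conj (hh : IsSymbRoot X Y γ h) (hγ : IsDispersion X Y γ) (θ : ℝ) :
    h θ * (starRingEnd ℂ) (h θ) = 1 := by
  rw [Complex.mul_conj, hh.normSq_eq_one hγ]; simp

theorem inv_eq_conj (hh : IsSymbRoot X Y γ h) (hγ : IsDispersion X Y γ) (θ : ℝ) :
    (h θ)⁻¹ = (starRingEnd ℂ) (h θ) :=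
  inv_eq_of_mul_eq_one_right (hh.mul_conj hγ θ)

theorem congr (hh : IsSymbRoot X Y γ h) (hγ : IsDispersion X Y γ) {θ φ : ℝ}
    (hs : symb X Y θ = symb X Y φ) (hc : Real.cos θ = Real.cos φ) : h θ = h φ := by
  apply Complex.eq_of_sq_eq_sq_of_re_pos (hh.re_pos θ) (hh.re_pos φ)
  have h1 : ((Real.sinh (γ φ) : ℝ) : ℂ) ≠ 0 := by exact_mod_cast (hγ.sinh_pos φ).ne'
  apply mul_right_cancel₀ h1
  rw [hh.sq_mul, ← hs, ← hh.sq_mul, hγ.congr hc]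

theorem apply_neg (hh : IsSymbRoot X Y γ h) (hγ : IsDispersion X Y γ) (θ : ℝ) :
    h (-θ) = (h θ)⁻¹ := by
  rw [hh.inv_eq_conj hγ]
  apply Complex.eq_of_sq_eq_sq_of_re_pos (hh.re_pos _) (by simpa using hh.re_pos θ)
  have h1 : ((Real.sinh (γ θ) : ℝ) : ℂ) ≠ 0 := by exact_mod_cast (hγ.sinh_pos θ).ne'
  apply mul_right_cancel₀ h1
  have h2 := hh.sq_mul (-θ)
  rw [hγ.neg] at h2
  rw [h2, ← star_symb, ← hh.sq_mul, map_mul, map_pow, Complex.conj_ofReal]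

/-- The symbol times its inverse root: `sinh γ_θ / h_θ² = symb (-θ)`. -/
theorem sinh_eq (hh : IsSymbRoot X Y γ h) (hγ : IsDispersion X Y γ) (θ : ℝ) :
    ((Real.sinh (γ θ) : ℝ) : ℂ) = h θ ^ 2 * symb X Y (-θ) := by
  rw [← hh.sq_mul, hh.apply_neg hγ, hγ.neg, inv_pow, mul_inv_cancel_left₀]
  exact pow_ne_zero _ (hh.ne_zero θ)

theorem mul_inv_add_mul_inv_re_pos (hh : IsSymbRoot X Y γ h) (hγ : IsDispersion X Y γ)
    (θ φ : ℝ) : ∃ r : ℝ, 0 < r ∧ h θ / h φ + h φ / h θ = r := by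
  have hre (θ : ℝ) : |(h θ).im| < (h θ).re := by
    have h1 : 0 < (h θ ^ 2 * Real.sinh (γ θ)).re := by
      rw [hh.sq_mul]; exact symb_re_pos hγ.pos hγ.lt θ
    rw [Complex.re_mul_ofReal, mul_pos_iff_of_pos_right (hγ.sinh_pos θ), sq, Complex.mul_re] at h1
    exact abs_lt_of_sq_lt_sq (by linarith) (hh.re_pos θ).le
  refine ⟨2 * ((h θ).re * (h φ).re + (h θ).im * (h φ).im), ?_, ?_⟩
  · have h1 := hre θ
    have h2 := hre φ
    have h3 : |(h θ).im * (h φ).im| < (h θ).re * (h φ).re := by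
      rw [abs_mul]
      exact mul_lt_mul'' h1 h2 (abs_nonneg _) (abs_nonneg _)
    linarith [(abs_lt.1 h3).1]
  · rw [div_eq_mul_inv, div_eq_mul_inv, hh.inv_eq_conj hγ, hh.inv_eq_conj hγ]
    apply Complex.ext <;> simp <;> ring

end IsSymbRoot

theorem exp_mul_exp_neg (θ : ℝ) :
    Complex.exp (Complex.I * θ) * Complex.exp (-Complex.I * θ) = 1 := by
  rw [← Complex.exp_add]; simp

theorem symb_eq_mul (x y θ : ℝ) :
    symb (2 * x) (2 * y) θ =
      2 * (Real.cosh x * Real.sinh y - Real.sinh x * Real.cosh y * Complex.exp (Complex.I * θ)) *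
        (Real.cosh x * Real.cosh y - Real.sinh x * Real.sinh y *
          Complex.exp (-Complex.I * θ)) := by
  have e1 : Complex.exp (Complex.I * θ) = Real.cos θ + Complex.I * Real.sin θ := by
    rw [mul_comm, Complex.exp_mul_I]; push_cast; ring
  have e2 : Complex.exp (-Complex.I * θ) = Real.cos θ - Complex.I * Real.sin θ := by
    have : -Complex.I * θ = (-θ : ℂ) * Complex.I := by ring
    rw [this, Complex.exp_mul_I, Complex.cos_neg, Complex.sin_neg]; push_cast; ring
  have h3 := exp_mul_exp_neg θ
  rw [e1, e2] at h3 ⊢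
  rw [symb, Real.cosh_two_mul, Real.sinh_two_mul, Real.sinh_two_mul, Real.cosh_two_mul]
  have h2 : (Real.cosh y : ℂ) ^ 2 = Real.sinh y ^ 2 + 1 := by exact_mod_cast Real.cosh_sq y
  generalize Real.cosh x = a at *
  generalize Real.cosh y = b at *
  generalize Real.sinh x = c at *
  generalize Real.sinh y = d at *
  generalize Real.cos θ = e at *
  generalize Real.sin θ = f at *
  push_cast
  linear_combination (-2 * (c : ℂ) ^ 2 * b * d) * h3 + (2 * Complex.I * c * a * f) * h2

theorem isSymbRoot_sqb {x y : ℝ} {γ : ℝ → ℝ} (hγ : IsDispersion (2 * x) (2 * y) γ) {α β : ℝ}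
    (hα : α = Real.tanh x * (Real.cosh y / Real.sinh y)) (hβ : β = Real.tanh x * Real.tanh y) :
    IsSymbRoot (2 * x) (2 * y) γ (sqb α β) := by
  have hx := Real.cosh_pos x
  have hy := Real.cosh_pos y
  have hsy : 0 < Real.sinh y := Real.sinh_pos_iff.2 (by linarith [hγ.pos_right])
  have hs : ∀ θ, ((Real.sinh (γ θ) : ℝ) : ℂ) ≠ 0 := fun θ => by
    exact_mod_cast (hγ.sinh_pos θ).ne'
  have hne : ∀ θ, symb (2 * x) (2 * y) θ ≠ 0 := fun θ h0 => by
    have := symb_re_pos hγ.pos hγ.lt θ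
    simp [h0] at this
  have hre : ∀ θ, 0 < (symb (2 * x) (2 * y) θ / (Real.sinh (γ θ) : ℝ)).re := fun θ => by
    rw [Complex.div_ofReal_re]
    exact div_pos (symb_re_pos hγ.pos hγ.lt θ) (hγ.sinh_pos θ)
  have hsymb : ∀ θ : ℝ, symb (2 * x) (2 * y) θ =
      2 * Real.cosh x ^ 2 * Real.sinh y * Real.cosh y *
        ((1 - α * Complex.exp (Complex.I * θ)) * (1 - β * Complex.exp (-Complex.I * θ))) := by
    intro θ
    rw [symb_eq_mul, hα, hβ, Real.tanh_eq_sinh_div_cosh, Real.tanh_eq_sinh_div_cosh]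
    have h1 : (Real.cosh x : ℂ) ≠ 0 := by exact_mod_cast hx.ne'
    have h2 : (Real.cosh y : ℂ) ≠ 0 := by exact_mod_cast hy.ne'
    have h3 : (Real.sinh y : ℂ) ≠ 0 := by exact_mod_cast hsy.ne'
    generalize Real.cosh x = a at *
    generalize Real.cosh y = b at *
    generalize Real.sinh y = d at *
    push_cast
    field_simp
  have hb : ∀ θ, bfun α β θ = symb (2 * x) (2 * y) θ / (Real.sinh (γ θ) : ℝ) := by
    intro θ
    rw [bfun, ← Complex.sq_cpow_two_inv (hre θ)]
    congr 1
    have hk : (2 * Real.cosh x ^ 2 * Real.sinh y * Real.cosh y : ℂ) ≠ 0 := by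
      have : 0 < 2 * Real.cosh x ^ 2 * Real.sinh y * Real.cosh y := by positivity
      exact_mod_cast this.ne'
    have h1 : symb (2 * x) (2 * y) (-θ) =
      2 * Real.cosh x ^ 2 * Real.sinh y * Real.cosh y *
        ((1 - β * Complex.exp (Complex.I * θ)) * (1 - α * Complex.exp (-Complex.I * θ))) := by
      rw [hsymb]; push_cast
      simp only [neg_mul, mul_neg, neg_neg]
      ring
    rw [← mul_div_mul_left _ _ hk, ← hsymb, ← h1, div_pow, ← hγ.symb_mul_symb_neg, sq,
      mul_div_mul_left _ _ (hne θ)]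
  constructor
  · intro θ
    rw [sqb, hb, ← Nat.cast_ofNat (R := ℂ) (n := 2), Complex.cpow_nat_inv_pow _ two_ne_zero,
      div_mul_cancel₀ _ (hs θ)]
  · intro θ
    rw [sqb, hb]
    exact Complex.cpow_two_inv_re_pos (hre θ)

/-- The quadratic polynomial `p T² + q T + r` over `ℂ` with real coefficients. -/
def realQuad (p q r : ℝ) : Polynomial ℂ :=
  Polynomial.C (p : ℂ) * Polynomial.X ^ 2 + Polynomial.C (q : ℂ) * Polynomial.X +
    Polynomial.C (r : ℂ)

theorem natDegree_realQuad_le (p q r : ℝ) : (realQuad p q r).natDegree ≤ 2 :=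
  Polynomial.natDegree_quadratic_le

@[simp] theorem coeff_two_realQuad (p q r : ℝ) : (realQuad p q r).coeff 2 = p := by
  simp [realQuad]

@[simp] theorem coeff_zero_realQuad (p q r : ℝ) : (realQuad p q r).coeff 0 = r := by
  simp [realQuad]

theorem eval_realQuad (p q r : ℝ) (z : ℂ) : (realQuad p q r).eval z = p * z ^ 2 + q * z + r := by
  simp [realQuad]

/-- `e^{iθ} symb θ` as a quadratic polynomial in `e^{iθ}`. -/
def symbPoly (X Y : ℝ) : Polynomial ℂ :=
  realQuad (-(Real.sinh X * (Real.cosh Y + 1) / 2)) (Real.cosh X * Real.sinh Y)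
    (-(Real.sinh X * (Real.cosh Y - 1) / 2))

/-- `e^{iθ} symb (-θ)` as a quadratic polynomial in `e^{iθ}`. -/
def symbPolyNeg (X Y : ℝ) : Polynomial ℂ :=
  realQuad (-(Real.sinh X * (Real.cosh Y - 1) / 2)) (Real.cosh X * Real.sinh Y)
    (-(Real.sinh X * (Real.cosh Y + 1) / 2))

/-- `e^{iθ} cosh γ_θ` as a quadratic polynomial in `e^{iθ}`. -/
def coshPoly (X Y : ℝ) : Polynomial ℂ :=
  realQuad (-(Real.sinh X * Real.sinh Y / 2)) (Real.cosh X * Real.cosh Y)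
    (-(Real.sinh X * Real.sinh Y / 2))

theorem exp_mul_two_cos (θ : ℝ) :
    Complex.exp (Complex.I * θ) * (2 * (Real.cos θ : ℂ)) = Complex.exp (Complex.I * θ) ^ 2 + 1 := by
  have h1 := exp_mul_exp_neg θ
  have h2 : Complex.exp (-Complex.I * θ) = Complex.exp (-θ * Complex.I) := by
    congr 1; ring
  rw [h2] at h1
  rw [mul_comm Complex.I] at h1 ⊢
  rw [Complex.ofReal_cos, Complex.two_cos, mul_add, h1]; ring

theorem exp_mul_two_I_sin (θ : ℝ) :
    Complex.exp (Complex.I * θ) * (2 * Complex.I * (Real.sin θ : ℂ)) =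
      Complex.exp (Complex.I * θ) ^ 2 - 1 := by
  have h1 := exp_mul_two_cos θ
  have e1 : Complex.exp (Complex.I * θ) = Real.cos θ + Complex.I * Real.sin θ := by
    rw [mul_comm, Complex.exp_mul_I]; push_cast; ring
  linear_combination (2 * Complex.exp (Complex.I * θ)) * (-e1) - h1

theorem eval_symbPoly (X Y θ : ℝ) : (symbPoly X Y).eval (Complex.exp (Complex.I * θ)) =
    Complex.exp (Complex.I * θ) * symb X Y θ := by
  have h1 := exp_mul_two_cos θ
  have h2 := exp_mul_two_I_sin θ
  rw [symbPoly, eval_realQuad, symb]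
  push_cast at h1 h2 ⊢
  linear_combination (Complex.sinh X * Complex.cosh Y / 2) * h1 + (Complex.sinh X / 2) * h2

theorem eval_symbPolyNeg (X Y θ : ℝ) : (symbPolyNeg X Y).eval (Complex.exp (Complex.I * θ)) =
    Complex.exp (Complex.I * θ) * symb X Y (-θ) := by
  have h1 := exp_mul_two_cos θ
  have h2 := exp_mul_two_I_sin θ
  rw [symbPolyNeg, eval_realQuad, symb, Real.cos_neg, Real.sin_neg]
  push_cast at h1 h2 ⊢
  linear_combination (Complex.sinh X * Complex.cosh Y / 2) * h1 - (Complex.sinh X / 2) * h2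

theorem IsDispersion.eval_coshPoly {X Y : ℝ} {γ : ℝ → ℝ} (hγ : IsDispersion X Y γ) (θ : ℝ) :
    (coshPoly X Y).eval (Complex.exp (Complex.I * θ)) =
      Complex.exp (Complex.I * θ) * (Real.cosh (γ θ) : ℝ) := by
  have h1 := exp_mul_two_cos θ
  rw [coshPoly, eval_realQuad, hγ.cosh_eq]
  push_cast at h1 ⊢
  linear_combination (Complex.sinh X * Complex.sinh Y / 2) * h1

/-- Pairs of polynomials of degree at most `n` whose extreme coefficients are proportional as in
the asymptotics of `1 : symb / sinh γ` at `e^{iθ} = 0, ∞`. -/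
structure IsAdmissible (Y : ℝ) (n : ℕ) (U V : Polynomial ℂ) : Prop where
  left_le : U.natDegree ≤ n
  right_le : V.natDegree ≤ n
  top : (Real.sinh Y : ℂ) * V.coeff n = (Real.cosh Y + 1) * U.coeff n
  bot : (Real.sinh Y : ℂ) * V.coeff 0 = (Real.cosh Y - 1) * U.coeff 0

theorem IsAdmissible.step {Y : ℝ} (hY : 0 < Y) {n : ℕ} {U V : Polynomial ℂ}
    (h : IsAdmissible Y n U V) (X a d b : ℝ) :
    IsAdmissible Y (n + 2)
      (U * (Polynomial.C (a : ℂ) * coshPoly X Y - Polynomial.C (d : ℂ) * Polynomial.X) +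
        V * (Polynomial.C (b : ℂ) * symbPolyNeg X Y))
      (V * (Polynomial.C (a : ℂ) * coshPoly X Y - Polynomial.C (d : ℂ) * Polynomial.X) +
        U * (Polynomial.C (b : ℂ) * symbPoly X Y)) := by
  have d1 : (Polynomial.C (a : ℂ) * coshPoly X Y - Polynomial.C (d : ℂ) * Polynomial.X).natDegree
      ≤ 2 := by
    refine (Polynomial.natDegree_sub_le _ _).trans (max_le ?_ ?_)
    · exact (Polynomial.natDegree_C_mul_le _ _).trans (natDegree_realQuad_le _ _ _)
    · exact (Polynomial.natDegree_C_mul_le _ _).trans (Polynomial.natDegree_X_le.trans one_le_two)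
  have d2 : (Polynomial.C (b : ℂ) * symbPolyNeg X Y).natDegree ≤ 2 :=
    (Polynomial.natDegree_C_mul_le _ _).trans (natDegree_realQuad_le _ _ _)
  have d3 : (Polynomial.C (b : ℂ) * symbPoly X Y).natDegree ≤ 2 :=
    (Polynomial.natDegree_C_mul_le _ _).trans (natDegree_realQuad_le _ _ _)
  have hsq : (Real.sinh Y : ℂ) ^ 2 = (Real.cosh Y - 1) * (Real.cosh Y + 1) := by
    have := Real.sinh_sq Y
    have h2 : Real.sinh Y ^ 2 = (Real.cosh Y - 1) * (Real.cosh Y + 1) := by rw [this]; ring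
    exact_mod_cast h2
  have hs : (Real.sinh Y : ℂ) ≠ 0 := by exact_mod_cast (Real.sinh_pos_iff.2 hY).ne'
  have ht := h.top
  have hb := h.bot
  constructor
  · exact Polynomial.natDegree_add_le_of_degree_le
      (Polynomial.natDegree_mul_le_of_le h.left_le d1)
      (Polynomial.natDegree_mul_le_of_le h.right_le d2)
  · exact Polynomial.natDegree_add_le_of_degree_le
      (Polynomial.natDegree_mul_le_of_le h.right_le d1)
      (Polynomial.natDegree_mul_le_of_le h.left_le d3)
  · rw [Polynomial.coeff_add, Polynomial.coeff_add,
      Polynomial.coeff_mul_add_eq_of_natDegree_le h.right_le d1,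
      Polynomial.coeff_mul_add_eq_of_natDegree_le h.left_le d1,
      Polynomial.coeff_mul_add_eq_of_natDegree_le h.right_le d2,
      Polynomial.coeff_mul_add_eq_of_natDegree_le h.left_le d3]
    simp only [Polynomial.coeff_sub, Polynomial.coeff_C_mul, coshPoly, symbPoly, symbPolyNeg,
      coeff_two_realQuad, Polynomial.coeff_X_of_ne_one (by norm_num : (2 : ℕ) ≠ 1)]
    generalize Real.cosh Y = c at *
    generalize Real.sinh Y = s at *
    generalize Real.sinh X = x at *
    generalize U.coeff n = u at *
    generalize V.coeff n = v at *
    apply mul_left_cancel₀ hs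
    push_cast
    linear_combination (-(s : ℂ) ^ 2 * a * x / 2) * ht + (b * x * (c - 1) * (c + 1) / 2) * ht -
      (b * x * (c + 1) / 2) * u * hsq
  · simp only [Polynomial.coeff_sub, Polynomial.coeff_add, Polynomial.mul_coeff_zero, coshPoly,
      symbPoly, symbPolyNeg, coeff_zero_realQuad, Polynomial.coeff_X_zero, Polynomial.coeff_C_zero]
    generalize Real.cosh Y = c at *
    generalize Real.sinh Y = s at *
    generalize Real.sinh X = x at *
    generalize U.coeff 0 = u at *
    generalize V.coeff 0 = v at *
    apply mul_left_cancel₀ hs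
    push_cast
    linear_combination (-(s : ℂ) ^ 2 * a * x / 2) * hb + (b * x * (c - 1) * (c + 1) / 2) * hb -
      (b * x * (c - 1) / 2) * u * hsq

/-- Multiplying an admissible pair by functions `a cosh γ - d + b sinh γ` on the curve. -/
theorem IsAdmissible.exists_prod {X Y : ℝ} (hY : 0 < Y) {n : ℕ} {e f : Polynomial ℂ}
    (h : IsAdmissible Y n e f) (a d b : ℕ → ℝ) (M : ℕ) :
    ∃ U V, IsAdmissible Y (n + 2 * M) U V ∧
      ∀ z B s c : ℂ, (symbPoly X Y).eval z = z * (B * s) →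
        B * (symbPolyNeg X Y).eval z = z * s → (coshPoly X Y).eval z = z * c →
        U.eval z * B + V.eval z =
          (∏ i ∈ range M, (z * (a i * c - d i + b i * s))) * (e.eval z * B + f.eval z) := by
  induction M with
  | zero => exact ⟨e, f, h, by simp⟩
  | succ M ih =>
    obtain ⟨U, V, hUV, hp⟩ := ih
    refine ⟨_, _, hUV.step hY X (a M) (d M) (b M), fun z B s c h1 h2 h3 => ?_⟩
    rw [prod_range_succ, mul_right_comm, ← hp z B s c h1 h2 h3]
    simp only [Polynomial.eval_add, Polynomial.eval_mul, Polynomial.eval_sub, Polynomial.eval_C,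
      Polynomial.eval_X, h1, h3]
    linear_combination (V.eval z * b M) * h2

/-- The antiperiodic momentum `(2 * i + 1)π/N`, for any natural number `i`. -/
def angA (N i : ℕ) : ℝ := (2 * (i : ℝ) + 1) * Real.pi / N

/-- The periodic momentum `2 * i * π / N`, for any natural number `i`. -/
def angP (N i : ℕ) : ℝ := 2 * (i : ℝ) * Real.pi / N

theorem prod_range_two_mul {R : Type*} [CommMonoid R] (G : ℕ → R) (M : ℕ) :
    ∏ i ∈ range (2 * M), G i = ∏ i ∈ range M, (G i * G (2 * M - 1 - i)) := by
  rw [two_mul, prod_range_add, prod_mul_distrib, ← prod_range_reflect (fun i => G (M + i))]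
  congr 1
  refine prod_congr rfl fun i hi => ?_
  rw [mem_range] at hi
  congr 1
  omega

theorem prod_range_two_mul_add_one {R : Type*} [CommMonoid R] (G : ℕ → R) (M : ℕ) :
    ∏ i ∈ range (2 * M + 1), G i = (∏ i ∈ range M, (G i * G (2 * M - i))) * G M := by
  rw [show 2 * M + 1 = M + 1 + M by ring, prod_range_add, prod_range_succ, prod_mul_distrib,
    ← prod_range_reflect (fun i => G (M + 1 + i)), mul_right_comm]
  congr 2
  refine prod_congr rfl fun i hi => ?_
  rw [mem_range] at hi
  congr 1
  omega

section Angles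

variable {R : Type*} [CommMonoid R] (F : ℝ → R)

theorem prod_angA_odd (M : ℕ) :
    ∏ i ∈ range (2 * M + 1), F (angA (2 * M + 1) i) =
      (∏ i ∈ range M, (F (angA (2 * M + 1) i) * F (2 * Real.pi - angA (2 * M + 1) i))) *
        F Real.pi := by
  have hN : (2 * (M : ℝ) + 1) ≠ 0 := by positivity
  rw [prod_range_two_mul_add_one]
  congr 1
  · refine prod_congr rfl fun i hi => ?_
    rw [mem_range] at hi
    congr 2
    rw [angA, angA, Nat.cast_sub (by omega)]
    push_cast
    field_simp
    ring
  · rw [angA]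
    push_cast
    congr 1
    field_simp

theorem prod_angP_odd (M : ℕ) :
    ∏ i ∈ range (2 * M + 1), F (angP (2 * M + 1) i) =
      F 0 * ∏ i ∈ range M, (F (angP (2 * M + 1) (i + 1)) *
        F (2 * Real.pi - angP (2 * M + 1) (i + 1))) := by
  have hN : (2 * (M : ℝ) + 1) ≠ 0 := by positivity
  rw [prod_range_succ', prod_range_two_mul, mul_comm (F 0)]
  congr 1
  swap
  · simp [angP]
  · refine prod_congr rfl fun i hi => ?_
    rw [mem_range] at hi
    congr 2
    rw [angP, angP, show 2 * M - 1 - i + 1 = 2 * M - i by omega, Nat.cast_sub (by omega)]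
    push_cast
    field_simp
    ring

theorem prod_angA_even (M : ℕ) :
    ∏ i ∈ range (2 * M + 2), F (angA (2 * M + 2) i) =
      ∏ i ∈ range (M + 1), (F (angA (2 * M + 2) i) * F (2 * Real.pi - angA (2 * M + 2) i)) := by
  have hN : (2 * (M : ℝ) + 2) ≠ 0 := by positivity
  rw [show range (2 * M + 2) = range (2 * (M + 1)) from rfl, prod_range_two_mul]
  refine prod_congr rfl fun i hi => ?_
  rw [mem_range] at hi
  congr 2
  rw [angA, angA, show 2 * (M + 1) - 1 - i = 2 * M + 1 - i by omega, Nat.cast_sub (by omega)]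
  push_cast
  field_simp
  ring

theorem prod_angP_even (M : ℕ) :
    ∏ i ∈ range (2 * M + 2), F (angP (2 * M + 2) i) =
      F 0 * F Real.pi * ∏ i ∈ range M, (F (angP (2 * M + 2) (i + 1)) *
        F (2 * Real.pi - angP (2 * M + 2) (i + 1))) := by
  have hN : (2 * (M : ℝ) + 2) ≠ 0 := by positivity
  rw [prod_range_succ', prod_range_two_mul_add_one, mul_comm, mul_assoc]
  congr 1
  · simp [angP]
  · rw [mul_comm]
    congr 1
    · rw [angP]; push_cast; congr 1; field_simp
    · refine prod_congr rfl fun i hi => ?_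
      rw [mem_range] at hi
      congr 2
      rw [angP, angP, Nat.cast_add, Nat.cast_sub (by omega)]
      push_cast
      field_simp
      ring

end Angles

theorem exp_angP {N : ℕ} (i : ℕ) :
    Complex.exp (Complex.I * angP N i) = Complex.exp (2 * Real.pi * Complex.I / N) ^ i := by
  rw [← Complex.exp_nat_mul, angP]; push_cast; congr 1; ring

theorem exp_angA {N : ℕ} (i : ℕ) :
    Complex.exp (Complex.I * angA N i) =
      Complex.exp (2 * Real.pi * Complex.I / N) ^ i * Complex.exp (Complex.I * (Real.pi / N)) := by
  rw [← Complex.exp_nat_mul, angA, ← Complex.exp_add]; push_cast; congr 1; ring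

theorem exp_angP_pow {N : ℕ} (hN : N ≠ 0) (i : ℕ) :
    Complex.exp (Complex.I * angP N i) ^ N = 1 := by
  have h0 : (N : ℂ) ≠ 0 := by exact_mod_cast hN
  rw [← Complex.exp_nat_mul, angP, Complex.exp_eq_one_iff]
  exact ⟨i, by push_cast; field_simp⟩

theorem exp_pi_div_pow {N : ℕ} (hN : N ≠ 0) :
    Complex.exp (Complex.I * (Real.pi / N)) ^ N = -1 := by
  have h0 : (N : ℂ) ≠ 0 := by exact_mod_cast hN
  rw [← Complex.exp_nat_mul, ← Complex.exp_pi_mul_I]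
  congr 1
  field_simp

theorem exp_angA_pow {N : ℕ} (hN : N ≠ 0) (i : ℕ) :
    Complex.exp (Complex.I * angA N i) ^ N = -1 := by
  rw [exp_angA, mul_pow, exp_pi_div_pow hN, pow_right_comm,
    (Complex.isPrimitiveRoot_exp N hN).pow_eq_one]
  simp

theorem prod_sub_exp_angA {N : ℕ} (hN : N ≠ 0) (z : ℂ) :
    ∏ i ∈ range N, (z - Complex.exp (Complex.I * angA N i)) = z ^ N + 1 := by
  have h := congrArg (Polynomial.eval z) (X_pow_sub_C_eq_prod (Complex.isPrimitiveRoot_exp N hN)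
    (Nat.pos_of_ne_zero hN) (exp_pi_div_pow hN))
  simp only [Polynomial.eval_sub, Polynomial.eval_pow, Polynomial.eval_X, Polynomial.eval_C,
    Polynomial.eval_prod, sub_neg_eq_add] at h
  simp only [exp_angA, h]

theorem prod_sub_exp_angP {N : ℕ} (hN : N ≠ 0) (z : ℂ) :
    ∏ i ∈ range N, (z - Complex.exp (Complex.I * angP N i)) = z ^ N - 1 := by
  have h := congrArg (Polynomial.eval z) (X_pow_sub_C_eq_prod (Complex.isPrimitiveRoot_exp N hN)
    (Nat.pos_of_ne_zero hN) (one_pow N))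
  simp only [Polynomial.eval_sub, Polynomial.eval_pow, Polynomial.eval_X, Polynomial.eval_C,
    Polynomial.eval_prod, mul_one] at h
  simp only [exp_angP, h]

theorem sub_exp_mul_sub_exp (θ φ : ℝ) :
    (Complex.exp (Complex.I * θ) - Complex.exp (Complex.I * φ)) *
      (Complex.exp (Complex.I * θ) - Complex.exp (Complex.I * (2 * Real.pi - φ : ℝ))) =
      Complex.exp (Complex.I * θ) * (2 * Real.cos θ - 2 * Real.cos φ : ℝ) := by
  have h1 := exp_mul_two_cos θ
  have h2 := exp_mul_two_cos φ
  have h3 := exp_mul_exp_neg φ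
  have h4 : Complex.exp (Complex.I * (2 * Real.pi - φ : ℝ)) = Complex.exp (-Complex.I * φ) := by
    rw [show Complex.I * ((2 * Real.pi - φ : ℝ) : ℂ) = -Complex.I * φ + 2 * Real.pi * Complex.I by
      push_cast; ring, Complex.exp_add, Complex.exp_two_pi_mul_I, mul_one]
  have h5 : (2 * (Real.cos φ : ℂ)) =
      Complex.exp (Complex.I * φ) + Complex.exp (-Complex.I * φ) := by
    apply mul_left_cancel₀ (Complex.exp_ne_zero (Complex.I * φ))
    linear_combination h2 - h3
  rw [h4]
  push_cast at h1 h5 ⊢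
  linear_combination h3 - h1 + Complex.exp (Complex.I * θ) * h5

theorem exp_I_mul_pi : Complex.exp (Complex.I * Real.pi) = -1 := by
  rw [mul_comm, Complex.exp_pi_mul_I]

theorem exp_pow_add_one_odd (M : ℕ) (θ : ℝ) :
    (Complex.exp (Complex.I * θ) + 1) * ∏ i ∈ range M, (Complex.exp (Complex.I * θ) *
      (2 * Real.cos θ - 2 * Real.cos (angA (2 * M + 1) i) : ℝ)) =
      Complex.exp (Complex.I * θ) ^ (2 * M + 1) + 1 := by
  rw [← prod_sub_exp_angA (by omega), prod_angA_odd (fun φ => Complex.exp (Complex.I * θ) -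
    Complex.exp (Complex.I * φ)), exp_I_mul_pi, mul_comm]
  simp only [sub_exp_mul_sub_exp, sub_neg_eq_add]

theorem exp_pow_sub_one_odd (M : ℕ) (θ : ℝ) :
    (Complex.exp (Complex.I * θ) - 1) * ∏ i ∈ range M, (Complex.exp (Complex.I * θ) *
      (2 * Real.cos θ - 2 * Real.cos (angP (2 * M + 1) (i + 1)) : ℝ)) =
      Complex.exp (Complex.I * θ) ^ (2 * M + 1) - 1 := by
  rw [← prod_sub_exp_angP (by omega), prod_angP_odd (fun φ => Complex.exp (Complex.I * θ) -
    Complex.exp (Complex.I * φ))]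
  simp only [sub_exp_mul_sub_exp, Complex.ofReal_zero, mul_zero, Complex.exp_zero]

theorem exp_pow_add_one_even (M : ℕ) (θ : ℝ) :
    ∏ i ∈ range (M + 1), (Complex.exp (Complex.I * θ) *
      (2 * Real.cos θ - 2 * Real.cos (angA (2 * M + 2) i) : ℝ)) =
      Complex.exp (Complex.I * θ) ^ (2 * M + 2) + 1 := by
  rw [← prod_sub_exp_angA (by omega), prod_angA_even (fun φ => Complex.exp (Complex.I * θ) -
    Complex.exp (Complex.I * φ))]
  simp only [sub_exp_mul_sub_exp]

theorem exp_pow_sub_one_even (M : ℕ) (θ : ℝ) :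
    (Complex.exp (Complex.I * θ) ^ 2 - 1) * ∏ i ∈ range M, (Complex.exp (Complex.I * θ) *
      (2 * Real.cos θ - 2 * Real.cos (angP (2 * M + 2) (i + 1)) : ℝ)) =
      Complex.exp (Complex.I * θ) ^ (2 * M + 2) - 1 := by
  rw [← prod_sub_exp_angP (N := 2 * M + 2) (by omega),
    prod_angP_even (fun φ => Complex.exp (Complex.I * θ) - Complex.exp (Complex.I * φ)),
    exp_I_mul_pi]
  simp only [sub_exp_mul_sub_exp, Complex.ofReal_zero, mul_zero, Complex.exp_zero]
  ring

namespace IsDispersion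

variable {X Y : ℝ} {γ : ℝ → ℝ}

theorem half_sinh_pos (h : IsDispersion X Y γ) (θ φ : ℝ) : 0 < Real.sinh ((γ θ + γ φ) / 2) :=
  Real.sinh_pos_iff.2 (by linarith [h.apply_pos θ, h.apply_pos φ])

theorem exp_nufun (h : IsDispersion X Y γ) (N : ℕ) (θ : ℝ) :
    Real.exp (nufun N γ θ) = (∏ i ∈ range N, Real.sinh ((γ θ + γ (angA N i)) / 2)) /
      ∏ i ∈ range N, Real.sinh ((γ θ + γ (angP N i)) / 2) := by
  have e1 := Fin.prod_univ_eq_prod_range (fun i => Real.sinh ((γ θ + γ (angA N i)) / 2)) N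
  have e2 := Fin.prod_univ_eq_prod_range (fun i => Real.sinh ((γ θ + γ (angP N i)) / 2)) N
  rw [← e1, ← e2, nufun, Real.exp_log]
  · rfl
  · exact div_pos (prod_pos fun _ _ => h.half_sinh_pos _ _)
      (prod_pos fun _ _ => h.half_sinh_pos _ _)

theorem apply_two_pi_sub (h : IsDispersion X Y γ) (φ : ℝ) : γ (2 * Real.pi - φ) = γ φ :=
  h.congr (Real.cos_two_pi_sub φ)

theorem exp_nufun_odd (h : IsDispersion X Y γ) (M : ℕ) (θ : ℝ) :
    Real.exp (nufun (2 * M + 1) γ θ) * Real.sinh ((γ θ + γ 0) / 2) =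
      ((∏ i ∈ range M, Real.sinh ((γ θ + γ (angA (2 * M + 1) i)) / 2)) /
        ∏ i ∈ range M, Real.sinh ((γ θ + γ (angP (2 * M + 1) (i + 1))) / 2)) ^ 2 *
        Real.sinh ((γ θ + γ Real.pi) / 2) := by
  have h0 := (h.half_sinh_pos θ 0).ne'
  have h1 : ∏ i ∈ range M, Real.sinh ((γ θ + γ (angP (2 * M + 1) (i + 1))) / 2) ≠ 0 :=
    (prod_pos fun _ _ => h.half_sinh_pos _ _).ne'
  rw [h.exp_nufun, prod_angA_odd (fun φ => Real.sinh ((γ θ + γ φ) / 2)),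
    prod_angP_odd (fun φ => Real.sinh ((γ θ + γ φ) / 2))]
  simp only [h.apply_two_pi_sub, prod_mul_distrib]
  field_simp

theorem exp_nufun_even (h : IsDispersion X Y γ) (M : ℕ) (θ : ℝ) :
    Real.exp (nufun (2 * M + 2) γ θ) *
      (Real.sinh ((γ θ + γ Real.pi) / 2) * Real.sinh ((γ θ + γ 0) / 2)) =
      ((∏ i ∈ range (M + 1), Real.sinh ((γ θ + γ (angA (2 * M + 2) i)) / 2)) /
        ∏ i ∈ range M, Real.sinh ((γ θ + γ (angP (2 * M + 2) (i + 1))) / 2)) ^ 2 := by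
  have h0 := (h.half_sinh_pos θ 0).ne'
  have h2 := (h.half_sinh_pos θ Real.pi).ne'
  have h1 : ∏ i ∈ range M, Real.sinh ((γ θ + γ (angP (2 * M + 2) (i + 1))) / 2) ≠ 0 :=
    (prod_pos fun _ _ => h.half_sinh_pos _ _).ne'
  rw [h.exp_nufun, prod_angA_even (fun φ => Real.sinh ((γ θ + γ φ) / 2)),
    prod_angP_even (fun φ => Real.sinh ((γ θ + γ φ) / 2))]
  simp only [h.apply_two_pi_sub, prod_mul_distrib]
  field_simp

end IsDispersion

theorem two_mul_cosh_sub_add (g u v : ℝ) :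
    2 * Real.cosh ((u - v) / 2) * Real.cosh g - 2 * Real.cosh ((u + v) / 2) +
      2 * Real.sinh ((u - v) / 2) * Real.sinh g =
      2 * Real.sinh ((g + u) / 2) * (2 * Real.sinh ((g - v) / 2)) := by
  have h1 := four_sinh_mul_sinh (g + (u - v) / 2) ((u + v) / 2)
  rw [Real.cosh_add, show g + (u - v) / 2 + (u + v) / 2 = g + u by ring,
    show g + (u - v) / 2 - (u + v) / 2 = g - v by ring] at h1
  linarith

section

variable {X Y : ℝ} {γ : ℝ → ℝ} {h : ℝ → ℂ}

theorem IsSymbRoot.eval_symbPoly (hh : IsSymbRoot X Y γ h) (θ : ℝ) :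
    (symbPoly X Y).eval (Complex.exp (Complex.I * θ)) =
      Complex.exp (Complex.I * θ) * (h θ ^ 2 * (Real.sinh (γ θ) : ℝ)) := by
  rw [_root_.eval_symbPoly, hh.sq_mul]

theorem IsSymbRoot.eval_symbPolyNeg (hh : IsSymbRoot X Y γ h) (hγ : IsDispersion X Y γ) (θ : ℝ) :
    h θ ^ 2 * (symbPolyNeg X Y).eval (Complex.exp (Complex.I * θ)) =
      Complex.exp (Complex.I * θ) * (Real.sinh (γ θ) : ℝ) := by
  rw [_root_.eval_symbPolyNeg, hh.sinh_eq hγ θ]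
  ring

theorem prod_mul_cosh (z : ℂ) (g : ℝ) (u v : ℕ → ℝ) (M : ℕ) :
    ∏ i ∈ range M, (z * ((2 * Real.cosh ((u i - v i) / 2) : ℝ) * (Real.cosh g : ℝ) -
      (2 * Real.cosh ((u i + v i) / 2) : ℝ) +
      (2 * Real.sinh ((u i - v i) / 2) : ℝ) * (Real.sinh g : ℝ))) =
    ((∏ i ∈ range M, (2 * Real.sinh ((g + u i) / 2)) : ℝ) : ℂ) *
      ((∏ i ∈ range M, (2 * Real.sinh ((g - v i) / 2)) : ℝ) : ℂ) * z ^ M := by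
  rw [prod_mul_distrib, prod_const, card_range, mul_comm, ← Complex.ofReal_mul, ← prod_mul_distrib,
    Complex.ofReal_prod]
  congr 1
  refine prod_congr rfl fun i _ => ?_
  rw [← two_mul_cosh_sub_add]
  simp only [Complex.ofReal_sub, Complex.ofReal_add, Complex.ofReal_mul]

theorem prod_two_sinh_neg (g : ℝ) (u v : ℕ → ℝ) (M : ℕ) :
    (∏ i ∈ range M, (2 * Real.sinh ((-g + u i) / 2))) *
      (∏ i ∈ range M, (2 * Real.sinh ((-g - v i) / 2))) =
    (∏ i ∈ range M, (2 * Real.sinh ((g - u i) / 2))) *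
      (∏ i ∈ range M, (2 * Real.sinh ((g + v i) / 2))) := by
  rw [← prod_mul_distrib, ← prod_mul_distrib]
  refine prod_congr rfl fun i _ => ?_
  rw [show (-g + u i) / 2 = -((g - u i) / 2) by ring,
    show (-g - v i) / 2 = -((g + v i) / 2) by ring, Real.sinh_neg, Real.sinh_neg]
  ring

theorem IsAdmissible.exists_prod_sinh (hγ : IsDispersion X Y γ) (hh : IsSymbRoot X Y γ h) {n : ℕ}
    {e f : Polynomial ℂ} (hef : IsAdmissible Y n e f) (A P : ℕ → ℝ) (M : ℕ) :
    ∃ U V, IsAdmissible Y (n + 2 * M) U V ∧ ∀ (θ : ℝ) (z : ℂ), z = Complex.exp (Complex.I * θ) →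
      U.eval z * h θ ^ 2 + V.eval z =
        ((∏ i ∈ range M, (2 * Real.sinh ((γ θ + γ (A i)) / 2)) : ℝ) : ℂ) *
          ((∏ i ∈ range M, (2 * Real.sinh ((γ θ - γ (P i)) / 2)) : ℝ) : ℂ) * z ^ M *
          (e.eval z * h θ ^ 2 + f.eval z) ∧
      -(U.eval z * h θ ^ 2) + V.eval z =
        ((∏ i ∈ range M, (2 * Real.sinh ((γ θ - γ (A i)) / 2)) : ℝ) : ℂ) *
          ((∏ i ∈ range M, (2 * Real.sinh ((γ θ + γ (P i)) / 2)) : ℝ) : ℂ) * z ^ M *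
          (-(e.eval z * h θ ^ 2) + f.eval z) := by
  obtain ⟨U, V, hUV, hp⟩ := hef.exists_prod (X := X) hγ.pos_right
    (fun i => 2 * Real.cosh ((γ (A i) - γ (P i)) / 2))
    (fun i => 2 * Real.cosh ((γ (A i) + γ (P i)) / 2))
    (fun i => 2 * Real.sinh ((γ (A i) - γ (P i)) / 2)) M
  refine ⟨U, V, hUV, fun θ z hz => ?_⟩
  subst hz
  have h1 := hh.eval_symbPoly θ
  have h2 := hh.eval_symbPolyNeg hγ θ
  have h3 := hγ.eval_coshPoly θ
  constructor
  · rw [hp _ _ _ _ h1 h2 h3, ← prod_mul_cosh]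
  · have h4 := hp _ (-h θ ^ 2) ((Real.sinh (-γ θ) : ℝ) : ℂ) ((Real.cosh (-γ θ) : ℝ) : ℂ)
      (by rw [h1, Real.sinh_neg]; push_cast; ring)
      (by rw [Real.sinh_neg]; push_cast at h2 ⊢; linear_combination -h2)
      (by rw [Real.cosh_neg, h3])
    rw [prod_mul_cosh, ← Complex.ofReal_mul, prod_two_sinh_neg, Complex.ofReal_mul] at h4
    linear_combination h4

end

section

variable {X Y : ℝ} {γ : ℝ → ℝ} {h : ℝ → ℂ}

theorem IsDispersion.half_sinh_mul_half_sinh (hγ : IsDispersion X Y γ) (θ : ℝ) :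
    2 * (Real.sinh ((γ θ + γ Real.pi) / 2) * Real.sinh ((γ θ + γ 0) / 2)) =
      Real.cosh (γ θ + Y) - Real.cosh X := by
  have h1 := four_sinh_mul_sinh (γ θ + Y) X
  rw [hγ.apply_pi, hγ.apply_zero, ← add_assoc, ← add_sub_assoc]
  linarith

theorem IsSymbRoot.add_inv (hγ : IsDispersion X Y γ) (hh : IsSymbRoot X Y γ h) (θ : ℝ) :
    h θ + (h θ)⁻¹ = 2 * ((h θ).re : ℝ) := by
  rw [hh.inv_eq_conj hγ, Complex.add_conj]
  push_cast
  ring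

theorem IsSymbRoot.sq_add_one (hγ : IsDispersion X Y γ) (hh : IsSymbRoot X Y γ h) (θ : ℝ) :
    h θ ^ 2 + 1 = h θ * (2 * ((h θ).re : ℝ)) := by
  rw [← hh.add_inv hγ, mul_add, mul_inv_cancel₀ (hh.ne_zero θ), sq]

theorem IsSymbRoot.sq_sub_one (hγ : IsDispersion X Y γ) (hh : IsSymbRoot X Y γ h) (θ : ℝ) :
    (h θ ^ 2 - 1) * (2 * ((h θ).re : ℝ) * (Real.sinh (γ θ) : ℝ)) * Complex.exp (Complex.I * θ) =
      - h θ * Real.sinh X * (Complex.exp (Complex.I * θ) ^ 2 - 1) := by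
  have h0 := hh.ne_zero θ
  have h1 := hh.sq_mul θ
  have h2 := hh.sq_mul (-θ)
  have h3 := exp_mul_two_I_sin θ
  have h4 : h θ * h (-θ) = 1 := by rw [hh.apply_neg hγ, mul_inv_cancel₀ h0]
  rw [← hh.add_inv hγ, ← hh.apply_neg hγ, ← h3]
  rw [hγ.neg, symb, Real.sin_neg, Real.cos_neg] at h2
  rw [symb] at h1
  apply mul_left_cancel₀ h0
  push_cast at *
  generalize Complex.exp (Complex.I * θ) = z
  generalize h (-θ) = k at *
  linear_combination (h θ ^ 2 * z) * (h1 - h2) +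
    z * Complex.sinh (γ θ) * (h θ ^ 2 + h θ * k) * h4

theorem IsSymbRoot.re_sq_mul (hγ : IsDispersion X Y γ) (hh : IsSymbRoot X Y γ h) (θ : ℝ) :
    (h θ).re ^ 2 * Real.sinh Y * Real.sinh (γ θ) =
      Real.sinh ((γ θ + γ Real.pi) / 2) * Real.sinh ((γ θ + γ 0) / 2) := by
  have h1 := hγ.half_sinh_mul_half_sinh θ
  have h2 := congrArg Complex.re (hh.sq_mul θ)
  have h3 := hh.normSq_eq_one hγ θ
  rw [Complex.re_mul_ofReal, sq, Complex.mul_re, symb] at h2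
  simp only [Complex.sub_re, Complex.ofReal_re, Complex.mul_re, Complex.I_re,
    Complex.I_im, Complex.ofReal_im] at h2
  rw [Complex.normSq_apply] at h3
  rw [Real.cosh_add, hγ.cosh_eq] at h1
  linear_combination (-1 / 2) * h1 + Real.sinh Y / 2 * h2 +
    Real.sinh Y * Real.sinh (γ θ) / 2 * h3 - Real.cosh X / 2 * Real.cosh_sq Y

theorem IsSymbRoot.sq_eq_one (hγ : IsDispersion X Y γ) (hh : IsSymbRoot X Y γ h) {θ : ℝ}
    (hz : Complex.exp (Complex.I * θ) ^ 2 = 1) : h θ ^ 2 = 1 := by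
  have h1 := hh.sq_sub_one hγ θ
  rw [hz, sub_self, mul_zero, mul_eq_zero, mul_eq_zero] at h1
  have h2 : (2 * ((h θ).re : ℝ) * (Real.sinh (γ θ) : ℝ) : ℂ) ≠ 0 := by
    have := mul_pos (mul_pos two_pos (hh.re_pos θ)) (hγ.sinh_pos θ)
    exact_mod_cast this.ne'
  have h3 := Complex.exp_ne_zero (Complex.I * θ)
  exact sub_eq_zero.1 ((h1.resolve_right h3).resolve_right h2)

theorem IsDispersion.prod_two_sinh (hγ : IsDispersion X Y γ) (A : ℕ → ℝ) (M : ℕ) (θ : ℝ) :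
    (∏ i ∈ range M, (2 * Real.sinh ((γ θ + γ (A i)) / 2))) *
      (∏ i ∈ range M, (2 * Real.sinh ((γ θ - γ (A i)) / 2))) =
      (-(Real.sinh X * Real.sinh Y)) ^ M *
        ∏ i ∈ range M, (2 * Real.cos θ - 2 * Real.cos (A i)) := by
  rw [← prod_mul_distrib]
  conv_rhs => rw [← card_range M, ← prod_const, card_range, ← prod_mul_distrib]
  refine prod_congr rfl fun i _ => ?_
  rw [hγ.two_sinh_mul_two_sinh]
  ring

theorem IsDispersion.exp_half_nufun_odd (hγ : IsDispersion X Y γ) (hh : IsSymbRoot X Y γ h)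
    (M : ℕ) (θ : ℝ) :
    Real.exp (nufun (2 * M + 1) γ θ / 2) * Real.sinh ((γ θ + γ 0) / 2) *
        ∏ i ∈ range M, (2 * Real.sinh ((γ θ + γ (angP (2 * M + 1) (i + 1))) / 2)) =
      (∏ i ∈ range M, (2 * Real.sinh ((γ θ + γ (angA (2 * M + 1) i)) / 2))) *
        ((h θ).re * Real.sqrt (Real.sinh Y) * Real.sqrt (Real.sinh (γ θ))) := by
  have hp (A : ℕ → ℝ) : 0 < ∏ i ∈ range M, Real.sinh ((γ θ + γ (A i)) / 2) :=
    prod_pos fun _ _ => hγ.half_sinh_pos _ _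
  have hpA := hp (fun i => angA (2 * M + 1) i)
  have hpP := hp (fun i => angP (2 * M + 1) (i + 1))
  have h0 := hγ.half_sinh_pos θ 0
  have h1 := hγ.exp_nufun_odd M θ
  have hr := hh.re_pos θ
  have hY := hγ.sinh_right_pos
  have hs := hγ.sinh_pos θ
  rw [div_pow, div_mul_eq_mul_div, eq_div_iff (by positivity)] at h1
  have hexp : Real.exp (nufun (2 * M + 1) γ θ / 2) ^ 2 = Real.exp (nufun (2 * M + 1) γ θ) := by
    rw [sq, ← Real.exp_add, add_halves]
  simp only [prod_mul_distrib, prod_const, card_range]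
  rw [mul_left_comm, mul_assoc (2 ^ M)]
  congr 1
  refine (sq_eq_sq₀ (by positivity) (by positivity)).1 ?_
  simp only [mul_pow]
  rw [hexp, Real.sq_sqrt hY.le, Real.sq_sqrt hs.le, hh.re_sq_mul hγ]
  linear_combination Real.sinh ((γ θ + γ 0) / 2) * h1

theorem IsDispersion.exp_half_nufun_even (hγ : IsDispersion X Y γ) (hh : IsSymbRoot X Y γ h)
    (M : ℕ) (θ : ℝ) :
    2 * (Real.exp (nufun (2 * M + 2) γ θ / 2) *
        ((h θ).re * Real.sqrt (Real.sinh Y) * Real.sqrt (Real.sinh (γ θ))) *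
        ∏ i ∈ range M, (2 * Real.sinh ((γ θ + γ (angP (2 * M + 2) (i + 1))) / 2))) =
      ∏ i ∈ range (M + 1), (2 * Real.sinh ((γ θ + γ (angA (2 * M + 2) i)) / 2)) := by
  have hp (M : ℕ) (A : ℕ → ℝ) : 0 < ∏ i ∈ range M, Real.sinh ((γ θ + γ (A i)) / 2) :=
    prod_pos fun _ _ => hγ.half_sinh_pos _ _
  have hpA := hp (M + 1) (fun i => angA (2 * M + 2) i)
  have hpP := hp M (fun i => angP (2 * M + 2) (i + 1))
  have h1 := hγ.exp_nufun_even M θ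
  have hr := hh.re_pos θ
  have hY := hγ.sinh_right_pos
  have hs := hγ.sinh_pos θ
  rw [div_pow, eq_div_iff (by positivity)] at h1
  have hexp : Real.exp (nufun (2 * M + 2) γ θ / 2) ^ 2 = Real.exp (nufun (2 * M + 2) γ θ) := by
    rw [sq, ← Real.exp_add, add_halves]
  simp only [prod_mul_distrib, prod_const, card_range]
  rw [mul_left_comm (Real.exp _ * _), ← mul_assoc 2, ← pow_succ']
  congr 1
  refine (sq_eq_sq₀ (by positivity) (by positivity)).1 ?_
  simp only [mul_pow]
  rw [hexp, Real.sq_sqrt hY.le, Real.sq_sqrt hs.le, hh.re_sq_mul hγ, h1]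

end

/-- Polynomials `U, V` such that `U b + V` vanishes at the periodic points of the curve
`w ^ 2 = sinh² γ` on the sheet `b = h²` and at the antiperiodic points on the other sheet, together
with the value of `U` at the antiperiodic momenta. -/
structure IsInterpolant (X Y : ℝ) (γ : ℝ → ℝ) (h : ℝ → ℂ) (N : ℕ) (U V : Polynomial ℂ)
    (κ : ℝ) : Prop where
  admissible : IsAdmissible Y N U V
  ne_zero : κ ≠ 0
  periodic : ∀ (θ : ℝ) (z : ℂ), z = Complex.exp (Complex.I * θ) → z ^ N = 1 →
    U.eval z * h θ ^ 2 + V.eval z = 0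
  antiperiodic : ∀ (θ : ℝ) (z : ℂ), z = Complex.exp (Complex.I * θ) → z ^ N = -1 →
    -(U.eval z * h θ ^ 2) + V.eval z = 0
  value : ∀ (θ : ℝ) (z : ℂ), z = Complex.exp (Complex.I * θ) → z ^ N = -1 →
    U.eval z * h θ * (Real.sqrt (Real.sinh (γ θ)) : ℝ) =
      κ * (Real.exp (γ θ / 2) : ℝ) * (Real.exp (nufun N γ θ / 2) : ℝ)
  norm : ∀ (θ : ℝ) (z : ℂ), z = Complex.exp (Complex.I * θ) →
    (U.eval z * h θ ^ 2 + V.eval z) * (-(U.eval z * h θ ^ 2) + V.eval z) *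
      (Real.sinh (γ θ) : ℝ) = κ ^ 2 * h θ ^ 2 * ((z ^ N) ^ 2 - 1)

section

variable {X Y : ℝ} {γ : ℝ → ℝ} {h : ℝ → ℂ}

theorem IsSymbRoot.one_sub_sq_sq_mul (hγ : IsDispersion X Y γ) (hh : IsSymbRoot X Y γ h) (θ : ℝ) :
    (1 - (h θ ^ 2) ^ 2) * (Real.sinh (γ θ) : ℝ) * Complex.exp (Complex.I * θ) =
      h θ ^ 2 * Real.sinh X * (Complex.exp (Complex.I * θ) ^ 2 - 1) := by
  linear_combination (-h θ) * hh.sq_sub_one hγ θ -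
    (h θ ^ 2 - 1) * (Real.sinh (γ θ) : ℝ) * Complex.exp (Complex.I * θ) * hh.sq_add_one hγ θ

theorem IsDispersion.exp_sub_exp_mul (hγ : IsDispersion X Y γ) (θ φ : ℝ) :
    (Real.exp (γ θ) - Real.exp (γ φ)) * (Real.exp (-γ θ) - Real.exp (γ φ)) =
      Real.exp (γ φ) * (Real.sinh X * Real.sinh Y * (2 * Real.cos θ - 2 * Real.cos φ)) := by
  have h1 := hγ.cosh_sub_cosh θ φ
  rw [Real.cosh_eq, Real.cosh_eq] at h1
  have h2 : Real.exp (γ θ) * Real.exp (-γ θ) = 1 := by rw [← Real.exp_add]; simp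
  have h3 : Real.exp (γ φ) * Real.exp (-γ φ) = 1 := by rw [← Real.exp_add]; simp
  linear_combination h2 - h3 - 2 * Real.exp (γ φ) * h1

theorem Real.exp_sub_exp (u v : ℝ) :
    Real.exp u - Real.exp v =
      Real.exp (v / 2) * (Real.exp (u / 2) * (2 * Real.sinh ((u - v) / 2))) := by
  have e1 : Real.exp u = Real.exp (v / 2) * (Real.exp (u / 2) * Real.exp ((u - v) / 2)) := by
    rw [← Real.exp_add, ← Real.exp_add]; ring_nf
  have e2 : Real.exp v = Real.exp (v / 2) * (Real.exp (u / 2) * Real.exp (-((u - v) / 2))) := by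
    rw [← Real.exp_add, ← Real.exp_add]; ring_nf
  rw [e1, e2, Real.sinh_eq]; ring

/-- Base pair for an odd number of momenta. -/
theorem exists_base_odd (hγ : IsDispersion X Y γ) (hh : IsSymbRoot X Y γ h) :
    ∃ e f, IsAdmissible Y 1 e f ∧ e.eval 1 + f.eval 1 = 0 ∧
      ∀ (θ : ℝ) (z : ℂ), z = Complex.exp (Complex.I * θ) →
        (z - 1) * (e.eval z * h θ ^ 2 + f.eval z) =
          2 * z * (Real.exp (γ θ) - Real.exp (γ 0) : ℝ) * (h θ ^ 2 + 1) ∧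
        (z - 1) * (-(e.eval z * h θ ^ 2) + f.eval z) =
          2 * z * (Real.exp (-γ θ) - Real.exp (γ 0) : ℝ) * (1 - h θ ^ 2) := by
  refine ⟨Polynomial.C ((-(Real.sinh X * (Real.exp Y - 1)) : ℝ) : ℂ) * Polynomial.X +
      Polynomial.C ((Real.sinh X * (Real.exp Y + 1) : ℝ) : ℂ),
    Polynomial.C ((-(Real.sinh X * (Real.exp Y + 1)) : ℝ) : ℂ) * Polynomial.X +
      Polynomial.C ((Real.sinh X * (Real.exp Y - 1) : ℝ) : ℂ),
    ⟨Polynomial.natDegree_linear_le, Polynomial.natDegree_linear_le, ?_, ?_⟩, ?_, ?_⟩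
  · have h1 := Real.cosh_sq Y
    rw [← Real.cosh_add_sinh Y]
    simp only [Polynomial.coeff_add, Polynomial.coeff_C_mul, Polynomial.coeff_X_one,
      Polynomial.coeff_C_succ]
    norm_cast
    linear_combination Real.sinh X * h1
  · have h1 := Real.cosh_sq Y
    rw [← Real.cosh_add_sinh Y]
    simp only [Polynomial.coeff_add, Polynomial.coeff_C_mul, Polynomial.coeff_X_zero,
      Polynomial.coeff_C_zero]
    norm_cast
    linear_combination (-Real.sinh X) * h1
  · simp only [Polynomial.eval_add, Polynomial.eval_mul, Polynomial.eval_C, Polynomial.eval_X]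
    push_cast
    ring
  · rintro θ z rfl
    have h1 := hh.eval_symbPoly θ
    have h2 := hh.eval_symbPolyNeg hγ θ
    have h3 := hγ.eval_coshPoly θ
    have h4 : (Real.exp (γ 0)) = (Real.cosh Y + Real.sinh Y) * (Real.cosh X - Real.sinh X) := by
      rw [hγ.apply_zero, sub_eq_add_neg, Real.exp_add, ← Real.cosh_add_sinh, ← Real.cosh_sub_sinh X]
    rw [← Real.cosh_add_sinh (γ θ), ← Real.cosh_sub_sinh (γ θ), ← Real.cosh_add_sinh Y, h4]
    rw [symbPoly, eval_realQuad] at h1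
    rw [symbPolyNeg, eval_realQuad] at h2
    rw [coshPoly, eval_realQuad] at h3
    simp only [Polynomial.eval_add, Polynomial.eval_mul, Polynomial.eval_C, Polynomial.eval_X]
    push_cast at *
    constructor
    · linear_combination 2 * (h θ ^ 2 + 1) * h3 + 2 * h1 + 2 * h2
    · linear_combination 2 * (1 - h θ ^ 2) * h3 + 2 * h1 - 2 * h2

/-- Base pair for an even number of momenta. -/
theorem exists_base_even (hγ : IsDispersion X Y γ) (hh : IsSymbRoot X Y γ h) (φ : ℝ) :
    ∃ e f, IsAdmissible Y 2 e f ∧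
      ∀ (θ : ℝ) (z : ℂ), z = Complex.exp (Complex.I * θ) →
        e.eval z * h θ ^ 2 + f.eval z =
          z * (Real.exp (γ φ) * Real.exp (γ θ) - 1 : ℝ) * (h θ ^ 2 - 1) ∧
        -(e.eval z * h θ ^ 2) + f.eval z =
          z * (Real.exp (γ φ) * Real.exp (-γ θ) - 1 : ℝ) * (-h θ ^ 2 - 1) := by
  set r := Real.exp (γ φ)
  refine ⟨realQuad (-(r * (Real.sinh X * (Real.sinh Y - Real.cosh Y + 1) / 2)))
      (r * (Real.cosh X * Real.cosh Y - Real.cosh X * Real.sinh Y) - 1)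
      (-(r * (Real.sinh X * (Real.sinh Y - Real.cosh Y - 1) / 2))),
    realQuad (-(r * (Real.sinh X * (Real.cosh Y + 1 - Real.sinh Y) / 2)))
      (r * (Real.cosh X * Real.sinh Y - Real.cosh X * Real.cosh Y) + 1)
      (-(r * (Real.sinh X * (Real.cosh Y - 1 - Real.sinh Y) / 2))),
    ⟨natDegree_realQuad_le _ _ _, natDegree_realQuad_le _ _ _, ?_, ?_⟩, ?_⟩
  · have h1 := Real.cosh_sq Y
    simp only [coeff_two_realQuad]
    norm_cast
    linear_combination (-r * Real.sinh X / 2) * h1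
  · have h1 := Real.cosh_sq Y
    simp only [coeff_zero_realQuad]
    norm_cast
    linear_combination (-r * Real.sinh X / 2) * h1
  · rintro θ z rfl
    have h1 := hh.eval_symbPoly θ
    have h2 := hh.eval_symbPolyNeg hγ θ
    have h3 := hγ.eval_coshPoly θ
    rw [← Real.cosh_add_sinh (γ θ), ← Real.cosh_sub_sinh (γ θ)]
    rw [symbPoly, eval_realQuad] at h1
    rw [symbPolyNeg, eval_realQuad] at h2
    rw [coshPoly, eval_realQuad] at h3
    simp only [eval_realQuad]
    push_cast at *
    constructor
    · linear_combination r * (h θ ^ 2 - 1) * h3 + r * h1 - r * h2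
    · linear_combination r * (-h θ ^ 2 - 1) * h3 + r * h1 + r * h2

end

section

variable {X Y : ℝ} {γ : ℝ → ℝ} {h : ℝ → ℂ}

theorem IsDispersion.prod_two_sinh_mul (hγ : IsDispersion X Y γ) (A : ℕ → ℝ) (M : ℕ) (θ : ℝ)
    (z : ℂ) :
    ((∏ i ∈ range M, (2 * Real.sinh ((γ θ + γ (A i)) / 2)) : ℝ) : ℂ) *
      ((∏ i ∈ range M, (2 * Real.sinh ((γ θ - γ (A i)) / 2)) : ℝ) : ℂ) * z ^ M =
    ((-(Real.sinh X * Real.sinh Y) : ℝ) : ℂ) ^ M *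
      ∏ i ∈ range M, (z * (2 * Real.cos θ - 2 * Real.cos (A i) : ℝ)) := by
  rw [← Complex.ofReal_mul, hγ.prod_two_sinh, prod_mul_distrib, prod_const, card_range,
    Complex.ofReal_mul, Complex.ofReal_pow, Complex.ofReal_prod]
  ring

theorem IsDispersion.prod_ne_zero (hγ : IsDispersion X Y γ) (A : ℕ → ℝ) (M : ℕ) (θ : ℝ) :
    ((∏ i ∈ range M, (2 * Real.sinh ((γ θ + γ (A i)) / 2)) : ℝ) : ℂ) ≠ 0 :=
  Complex.ofReal_ne_zero.2
    (prod_pos fun _ _ => mul_pos two_pos (hγ.half_sinh_pos _ _)).ne'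

theorem exists_isInterpolant_odd (hγ : IsDispersion X Y γ) (hh : IsSymbRoot X Y γ h) (M : ℕ) :
    ∃ U V κ, IsInterpolant X Y γ h (2 * M + 1) U V κ := by
  obtain ⟨e, f, hef, hone, hbase⟩ := exists_base_odd hγ hh
  obtain ⟨U, V, hUV, hprod⟩ := hef.exists_prod_sinh hγ hh (fun i => angA (2 * M + 1) i)
    (fun i => angP (2 * M + 1) (i + 1)) M
  have hX := hγ.sinh_left_pos
  have hY := hγ.sinh_right_pos
  set w := -(Real.sinh X * Real.sinh Y) with hw
  set κ := -(2 * Real.exp (γ 0 / 2) * w ^ (M + 1) / Real.sqrt (Real.sinh Y)) with hκ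
  have hw0 : w ≠ 0 := neg_ne_zero.2 (by positivity)
  have hκ1 : κ * Real.sqrt (Real.sinh Y) = -(2 * Real.exp (γ 0 / 2) * w ^ (M + 1)) := by
    rw [hκ]; field_simp
  have hκ2 : κ ^ 2 = 4 * Real.exp (γ 0) * (w ^ M) ^ 2 * Real.sinh X ^ 2 * Real.sinh Y := by
    have he : Real.exp (γ 0 / 2) ^ 2 = Real.exp (γ 0) := by rw [sq, ← Real.exp_add, add_halves]
    rw [hκ, neg_sq, div_pow, Real.sq_sqrt hY.le, ← he, div_eq_iff hY.ne', pow_succ]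
    linear_combination 4 * Real.exp (γ 0 / 2) ^ 2 * (w ^ M) ^ 2 *
      (w - Real.sinh X * Real.sinh Y) * hw
  have hAz (θ : ℝ) (z : ℂ) (hz : z = Complex.exp (Complex.I * θ)) :=
    hz ▸ exp_pow_add_one_odd M θ
  have hPz (θ : ℝ) (z : ℂ) (hz : z = Complex.exp (Complex.I * θ)) :=
    hz ▸ exp_pow_sub_one_odd M θ
  have hanti : ∀ (θ : ℝ) (z : ℂ), z = Complex.exp (Complex.I * θ) → z ^ (2 * M + 1) = -1 →
      -(U.eval z * h θ ^ 2) + V.eval z = 0 := by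
    intro θ z hz hzN
    rw [(hprod θ z hz).2]
    have h1 := hγ.prod_two_sinh_mul (fun i => angA (2 * M + 1) i) M θ z
    have h2 := hAz θ z hz
    have h3 := hγ.prod_ne_zero (fun i => angA (2 * M + 1) i) M θ
    rw [hzN, neg_add_cancel, mul_eq_zero] at h2
    rcases h2 with h2 | h2
    · have h4 : z = -1 := eq_neg_of_add_eq_zero_left h2
      have h5 := hh.sq_eq_one hγ (θ := θ) (by rw [← hz, h4]; norm_num)
      have h6 := (hbase θ z hz).2
      have h7 : z - 1 ≠ 0 := by rw [h4]; norm_num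
      rw [h5, sub_self, mul_zero] at h6
      rw [h5, (mul_eq_zero.1 h6).resolve_left h7, mul_zero]
    · rw [h2, mul_zero, mul_assoc, mul_eq_zero] at h1
      linear_combination
        (((∏ i ∈ range M, (2 * Real.sinh ((γ θ + γ (angP (2 * M + 1) (i + 1))) / 2)) : ℝ) : ℂ) *
        (-(e.eval z * h θ ^ 2) + f.eval z)) * h1.resolve_left h3
  refine ⟨U, V, κ, ⟨by rwa [add_comm] at hUV, ?_, ?_, hanti, ?_, ?_⟩⟩
  · exact neg_ne_zero.2 (div_ne_zero (mul_ne_zero (mul_ne_zero two_ne_zero (Real.exp_pos _).ne')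
      (pow_ne_zero _ hw0)) (Real.sqrt_pos.2 hY).ne')
  · intro θ z hz hzN
    rw [(hprod θ z hz).1]
    have h1 := hγ.prod_two_sinh_mul (fun i => angP (2 * M + 1) (i + 1)) M θ z
    have h2 := hPz θ z hz
    have h3 := hγ.prod_ne_zero (fun i => angP (2 * M + 1) (i + 1)) M θ
    rw [hzN, sub_self, mul_eq_zero] at h2
    rcases h2 with h2 | h2
    · have h4 : z = 1 := sub_eq_zero.1 h2
      rw [hh.sq_eq_one hγ (θ := θ) (by rw [← hz, h4]; norm_num), mul_one, h4, hone, mul_zero]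
    · rw [h2, mul_zero, mul_assoc, mul_eq_zero] at h1
      linear_combination
        (((∏ i ∈ range M, (2 * Real.sinh ((γ θ + γ (angA (2 * M + 1) i)) / 2)) : ℝ) : ℂ) *
        (e.eval z * h θ ^ 2 + f.eval z)) * h1.resolve_left h3
  · intro θ z hz hzN
    have h0 := hanti θ z hz hzN
    have h1 := hγ.prod_two_sinh_mul (fun i => angP (2 * M + 1) (i + 1)) M θ z
    have h2 := hPz θ z hz
    have h3 := hγ.prod_ne_zero (fun i => angP (2 * M + 1) (i + 1)) M θ
    have h4 := (hprod θ z hz).1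
    have h5 := (hbase θ z hz).1
    have h6 := congrArg Complex.ofReal (hγ.exp_half_nufun_odd hh M θ)
    have h7 := congrArg Complex.ofReal (hγ.two_sinh_mul_two_sinh θ 0)
    have h8 := exp_mul_two_cos θ
    rw [Real.exp_sub_exp] at h5
    rw [hh.sq_add_one hγ] at h5
    rw [← hz] at h8
    rw [Real.cos_zero] at h7
    have hκ3 := congrArg Complex.ofReal hκ1
    have hw3 := congrArg Complex.ofReal hw
    have hs0 : ((Real.sinh ((γ θ + γ 0) / 2) : ℝ) : ℂ) ≠ 0 :=
      Complex.ofReal_ne_zero.2 (hγ.half_sinh_pos _ _).ne'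
    have hh0 := hh.ne_zero θ
    have hz1 : z - 1 ≠ 0 := by
      intro hz1
      rw [sub_eq_zero.1 hz1, one_pow] at hzN
      norm_num at hzN
    rw [hzN] at h2
    set pA := ∏ i ∈ range M, (2 * Real.sinh ((γ θ + γ (angA (2 * M + 1) i)) / 2))
    set pP := ∏ i ∈ range M, (2 * Real.sinh ((γ θ + γ (angP (2 * M + 1) (i + 1))) / 2))
    set mP := ∏ i ∈ range M, (2 * Real.sinh ((γ θ - γ (angP (2 * M + 1) (i + 1))) / 2))
    set T := ∏ i ∈ range M, (z * (2 * Real.cos θ - 2 * Real.cos (angP (2 * M + 1) (i + 1)) : ℝ))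
    have hk : (z - 1) ^ 2 * (2 * h θ) * (Real.sinh ((γ θ + γ 0) / 2) : ℝ) * (pP : ℂ) ≠ 0 := by
      simp only [ne_eq, mul_eq_zero, pow_eq_zero_iff, OfNat.ofNat_ne_zero, not_false_eq_true,
        hz1, hh0, hs0, h3, or_self]
    apply mul_left_cancel₀ hk
    rw [← hw] at h1
    simp only [Complex.ofReal_mul, Complex.ofReal_neg, Complex.ofReal_pow, Complex.ofReal_sub,
      Complex.ofReal_ofNat, Complex.ofReal_one] at *
    generalize ((Real.exp (γ 0 / 2) : ℝ) : ℂ) = ρ at *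
    generalize ((Real.exp (γ θ / 2) : ℝ) : ℂ) = ε at *
    generalize ((Real.exp (nufun (2 * M + 1) γ θ / 2) : ℝ) : ℂ) = η at *
    generalize ((Real.sqrt (Real.sinh (γ θ)) : ℝ) : ℂ) = s at *
    generalize ((Real.sqrt (Real.sinh Y) : ℝ) : ℂ) = t at *
    generalize ((Real.sinh ((γ θ + γ 0) / 2) : ℝ) : ℂ) = s₀ at *
    generalize ((Real.sinh ((γ θ - γ 0) / 2) : ℝ) : ℂ) = s₁ at *
    generalize (((h θ).re : ℝ) : ℂ) = r at *
    linear_combination (z - 1) ^ 2 * s * s₀ * pP * (h4 - h0) +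
      (z - 1) * s * s₀ * pP * pA * mP * z ^ M * h5 +
      (z - 1) * s * s₀ * pA * (8 * z * ρ * ε * s₁ * h θ * r) * h1 +
      s * s₀ * pA * (8 * z * ρ * ε * s₁ * h θ * r) * w ^ M * h2 -
      4 * s * pA * z * ρ * ε * h θ * r * w ^ M * h7 +
      4 * s * pA * ρ * ε * h θ * r * w ^ M * Real.sinh X * Real.sinh Y * h8 -
      (z - 1) ^ 2 * 2 * h θ * κ * ε * h6 - (z - 1) ^ 2 * 2 * h θ * ε * pA * r * s * hκ3 +
      (z - 1) ^ 2 * 4 * h θ * ε * pA * r * s * ρ * w ^ M * hw3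
  · intro θ z hz
    rcases eq_or_ne z 1 with h1 | hz1
    · have h2 : e.eval z * h θ ^ 2 + f.eval z = 0 := by
        rw [hh.sq_eq_one hγ (θ := θ) (by rw [← hz, h1, one_pow]), mul_one, h1, hone]
      rw [(hprod θ z hz).1, h2, h1, one_pow]
      ring
    obtain ⟨h1, h2⟩ := hprod θ z hz
    obtain ⟨h3, h4⟩ := hbase θ z hz
    have h5 := congrArg Complex.ofReal (hγ.exp_sub_exp_mul θ 0)
    have h6 := hh.one_sub_sq_sq_mul hγ θ
    have h7 := hγ.prod_two_sinh_mul (fun i => angP (2 * M + 1) (i + 1)) M θ z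
    have h8 := hγ.prod_two_sinh_mul (fun i => angA (2 * M + 1) i) M θ z
    have h9 := exp_mul_two_cos θ
    have hA := hAz θ z hz
    have hP := hPz θ z hz
    have hκ3 := congrArg Complex.ofReal hκ2
    rw [← hz] at h6 h9
    rw [Real.cos_zero] at h5
    apply mul_left_cancel₀ (pow_ne_zero 2 (sub_ne_zero.2 hz1))
    rw [h1, h2]
    generalize ∏ i ∈ range M, (z * (2 * Real.cos θ - 2 * Real.cos (angP (2 * M + 1) (i + 1)) : ℝ)) =
      TP at *
    generalize ∏ i ∈ range M, (z * (2 * Real.cos θ - 2 * Real.cos (angA (2 * M + 1) i) : ℝ)) =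
      TA at *
    generalize ∏ i ∈ range M, (2 * Real.sinh ((γ θ + γ (angA (2 * M + 1) i)) / 2)) = pA at *
    generalize ∏ i ∈ range M, (2 * Real.sinh ((γ θ - γ (angA (2 * M + 1) i)) / 2)) = mA at *
    generalize ∏ i ∈ range M, (2 * Real.sinh ((γ θ + γ (angP (2 * M + 1) (i + 1))) / 2)) = pP at *
    generalize ∏ i ∈ range M, (2 * Real.sinh ((γ θ - γ (angP (2 * M + 1) (i + 1))) / 2)) = mP at *
    rw [← hw] at h7 h8
    simp only [Complex.ofReal_mul, Complex.ofReal_pow, Complex.ofReal_sub,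
      Complex.ofReal_ofNat, Complex.ofReal_one] at *
    generalize e.eval z * h θ ^ 2 + f.eval z = F at *
    generalize -(e.eval z * h θ ^ 2) + f.eval z = G at *
    generalize z ^ (2 * M + 1) = zN at *
    generalize ((Real.sinh (γ θ) : ℝ) : ℂ) = s at *
    generalize ((Real.exp (γ θ) : ℝ) : ℂ) = a at *
    generalize ((Real.exp (-γ θ) : ℝ) : ℂ) = a' at *
    generalize ((Real.exp (γ 0) : ℝ) : ℂ) = a₀ at *
    generalize ((Real.cos θ : ℝ) : ℂ) = c at *
    generalize ((Real.sinh X : ℝ) : ℂ) = x at *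
    generalize ((Real.sinh Y : ℝ) : ℂ) = y at *
    generalize h θ ^ 2 = b at *
    have q : pA * mA * z ^ M * (pP * mP * z ^ M) = w ^ M * TA * (w ^ M * TP) := by rw [h7, h8]
    have hFG : (z - 1) * F * ((z - 1) * G) = 4 * z ^ 2 * (a - a₀) * (a' - a₀) * (1 - b ^ 2) := by
      rw [h3, h4]; ring
    have hAP : (z + 1) * TA * ((z - 1) * TP) = (zN + 1) * (zN - 1) := by rw [hA, hP]
    linear_combination s * (z - 1) ^ 2 * F * G * q + s * (w ^ M) ^ 2 * TA * TP * hFG +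
      4 * s * (w ^ M) ^ 2 * TA * TP * z ^ 2 * (1 - b ^ 2) * h5 +
      4 * (w ^ M) ^ 2 * TA * TP * z * a₀ * x * y * (2 * c - 2) * h6 +
      4 * (w ^ M) ^ 2 * TA * TP * a₀ * x ^ 2 * y * b * (z ^ 2 - 1) * h9 +
      4 * (w ^ M) ^ 2 * a₀ * x ^ 2 * y * b * (z - 1) ^ 2 * hAP -
      (z - 1) ^ 2 * b * (zN ^ 2 - 1) * hκ3

end

section

variable {X Y : ℝ} {γ : ℝ → ℝ} {h : ℝ → ℂ}

theorem IsDispersion.exp_mul_sub_one_mul (hγ : IsDispersion X Y γ) (θ φ : ℝ) :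
    (Real.exp (γ φ) * Real.exp (γ θ) - 1) * (Real.exp (γ φ) * Real.exp (-γ θ) - 1) =
      Real.exp (γ φ) * (Real.sinh X * Real.sinh Y * (2 * Real.cos θ - 2 * Real.cos φ)) := by
  have h1 := hγ.cosh_sub_cosh θ φ
  rw [Real.cosh_eq, Real.cosh_eq] at h1
  have h2 : Real.exp (γ θ) * Real.exp (-γ θ) = 1 := by rw [← Real.exp_add]; simp
  have h3 : Real.exp (γ φ) * Real.exp (-γ φ) = 1 := by rw [← Real.exp_add]; simp
  linear_combination Real.exp (γ φ) ^ 2 * h2 - h3 - 2 * Real.exp (γ φ) * h1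

theorem Real.exp_mul_exp_sub_one (u v : ℝ) :
    Real.exp v * Real.exp u - 1 =
      Real.exp (v / 2) * (Real.exp (u / 2) * (2 * Real.sinh ((u + v) / 2))) := by
  have h1 := Real.exp_sub_exp u (-v)
  have h2 : Real.exp v * Real.exp (-v) = 1 := by rw [← Real.exp_add]; simp
  have h3 : Real.exp v * Real.exp (-v / 2) = Real.exp (v / 2) := by
    rw [← Real.exp_add]; ring_nf
  rw [sub_neg_eq_add] at h1
  linear_combination Real.exp v * h1 + h2 + Real.exp (u / 2) * (2 * Real.sinh ((u + v) / 2)) * h3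

theorem exists_isInterpolant_even (hγ : IsDispersion X Y γ) (hh : IsSymbRoot X Y γ h) (M : ℕ) :
    ∃ U V κ, IsInterpolant X Y γ h (2 * M + 2) U V κ := by
  set φ := angA (2 * M + 2) M with hφ
  obtain ⟨e, f, hef, hbase⟩ := exists_base_even hγ hh φ
  obtain ⟨U, V, hUV, hprod⟩ := hef.exists_prod_sinh hγ hh (fun i => angA (2 * M + 2) i)
    (fun i => angP (2 * M + 2) (i + 1)) M
  have hX := hγ.sinh_left_pos
  have hY := hγ.sinh_right_pos
  set w := -(Real.sinh X * Real.sinh Y) with hw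
  set κ := Real.exp (γ φ / 2) * Real.sinh X * Real.sqrt (Real.sinh Y) * w ^ M with hκ
  have hw0 : w ≠ 0 := neg_ne_zero.2 (by positivity)
  have hκ2 : κ ^ 2 = Real.exp (γ φ) * (w ^ M) ^ 2 * Real.sinh X ^ 2 * Real.sinh Y := by
    have he : Real.exp (γ φ / 2) ^ 2 = Real.exp (γ φ) := by rw [sq, ← Real.exp_add, add_halves]
    rw [hκ, mul_pow, mul_pow, mul_pow, Real.sq_sqrt hY.le, he]
    ring
  have hAz (θ : ℝ) (z : ℂ) (hz : z = Complex.exp (Complex.I * θ)) :=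
    hz ▸ exp_pow_add_one_even M θ
  have hPz (θ : ℝ) (z : ℂ) (hz : z = Complex.exp (Complex.I * θ)) :=
    hz ▸ exp_pow_sub_one_even M θ
  have hanti : ∀ (θ : ℝ) (z : ℂ), z = Complex.exp (Complex.I * θ) → z ^ (2 * M + 2) = -1 →
      -(U.eval z * h θ ^ 2) + V.eval z = 0 := by
    intro θ z hz hzN
    rw [(hprod θ z hz).2]
    have h1 := hγ.prod_two_sinh_mul (fun i => angA (2 * M + 2) i) M θ z
    have h2 := hAz θ z hz
    have h3 := hγ.prod_ne_zero (fun i => angA (2 * M + 2) i) M θ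
    rw [hzN, neg_add_cancel, prod_range_succ, mul_eq_zero] at h2
    rcases h2 with h2 | h2
    · rw [h2, mul_zero, mul_assoc, mul_eq_zero] at h1
      linear_combination
        (((∏ i ∈ range M, (2 * Real.sinh ((γ θ + γ (angP (2 * M + 2) (i + 1))) / 2)) : ℝ) : ℂ) *
        (-(e.eval z * h θ ^ 2) + f.eval z)) * h1.resolve_left h3
    · have hz0 : z ≠ 0 := hz ▸ Complex.exp_ne_zero _
      have h4 := Complex.ofReal_eq_zero.1 ((mul_eq_zero.1 h2).resolve_left hz0)
      have h5 : γ θ = γ φ := hγ.congr (by linarith)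
      rw [(hbase θ z hz).2, h5, ← Real.exp_add, add_neg_cancel, Real.exp_zero, sub_self]
      simp
  refine ⟨U, V, κ, ⟨by rwa [add_comm] at hUV, ?_, ?_, hanti, ?_, ?_⟩⟩
  · exact mul_ne_zero (by positivity) (pow_ne_zero _ hw0)
  · intro θ z hz hzN
    rw [(hprod θ z hz).1]
    have h1 := hγ.prod_two_sinh_mul (fun i => angP (2 * M + 2) (i + 1)) M θ z
    have h2 := hPz θ z hz
    have h3 := hγ.prod_ne_zero (fun i => angP (2 * M + 2) (i + 1)) M θ
    rw [hzN, sub_self, mul_eq_zero] at h2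
    rcases h2 with h2 | h2
    · rw [(hbase θ z hz).1, hh.sq_eq_one hγ (θ := θ) (by rw [← hz]; exact sub_eq_zero.1 h2)]
      simp
    · rw [h2, mul_zero, mul_assoc, mul_eq_zero] at h1
      linear_combination
        (((∏ i ∈ range M, (2 * Real.sinh ((γ θ + γ (angA (2 * M + 2) i)) / 2)) : ℝ) : ℂ) *
        (e.eval z * h θ ^ 2 + f.eval z)) * h1.resolve_left h3
  · intro θ z hz hzN
    have h0 := hanti θ z hz hzN
    have h1 := hγ.prod_two_sinh_mul (fun i => angP (2 * M + 2) (i + 1)) M θ z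
    have h2 := hPz θ z hz
    have h3 := hγ.prod_ne_zero (fun i => angP (2 * M + 2) (i + 1)) M θ
    have h4 := (hprod θ z hz).1
    have h5 := congrArg Complex.ofReal (Real.exp_mul_exp_sub_one (γ θ) (γ φ))
    have h6 := congrArg Complex.ofReal (hγ.exp_half_nufun_even hh M θ)
    have h7 := hh.sq_sub_one hγ θ
    have hκ3 := congrArg Complex.ofReal hκ
    have hs0 : ((Real.sqrt (Real.sinh (γ θ)) : ℝ) : ℂ) ≠ 0 :=
      Complex.ofReal_ne_zero.2 (Real.sqrt_pos.2 (hγ.sinh_pos _)).ne'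
    have hr0 : (((h θ).re : ℝ) : ℂ) ≠ 0 := Complex.ofReal_ne_zero.2 (hh.re_pos θ).ne'
    have hh0 := hh.ne_zero θ
    rw [(hbase θ z hz).1] at h4
    rw [← hz, ← Real.sq_sqrt (hγ.sinh_pos θ).le] at h7
    rw [hzN] at h2
    rw [prod_range_succ, ← hφ] at h6
    rw [← hw] at h1
    have hk : 4 * h θ * ((∏ i ∈ range M,
        (2 * Real.sinh ((γ θ + γ (angP (2 * M + 2) (i + 1))) / 2)) : ℝ) : ℂ) * ((h θ).re : ℝ) *
        (Real.sqrt (Real.sinh (γ θ)) : ℝ) ≠ 0 := by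
      simp only [ne_eq, mul_eq_zero, OfNat.ofNat_ne_zero, hh0, h3, hr0, hs0, or_self,
        not_false_eq_true]
    apply mul_left_cancel₀ hk
    generalize ∏ i ∈ range M, (2 * Real.sinh ((γ θ + γ (angA (2 * M + 2) i)) / 2)) = pA at *
    generalize ∏ i ∈ range M, (2 * Real.sinh ((γ θ + γ (angP (2 * M + 2) (i + 1))) / 2)) = pP at *
    generalize ∏ i ∈ range M, (2 * Real.sinh ((γ θ - γ (angP (2 * M + 2) (i + 1))) / 2)) = mP at *
    generalize ∏ i ∈ range M, (z * (2 * Real.cos θ - 2 * Real.cos (angP (2 * M + 2) (i + 1)) : ℝ)) =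
      T at *
    simp only [Complex.ofReal_mul, Complex.ofReal_pow, Complex.ofReal_ofNat] at *
    generalize ((Real.exp (γ φ) * Real.exp (γ θ) - 1 : ℝ) : ℂ) = E at *
    generalize ((Real.exp (γ φ / 2) : ℝ) : ℂ) = ρ at *
    generalize ((Real.exp (γ θ / 2) : ℝ) : ℂ) = ε at *
    generalize ((Real.exp (nufun (2 * M + 2) γ θ / 2) : ℝ) : ℂ) = η at *
    generalize ((Real.sqrt (Real.sinh (γ θ)) : ℝ) : ℂ) = S at *
    generalize ((Real.sqrt (Real.sinh Y) : ℝ) : ℂ) = t at *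
    generalize ((Real.sinh ((γ θ + γ φ) / 2) : ℝ) : ℂ) = s₀ at *
    generalize (((h θ).re : ℝ) : ℂ) = r at *
    generalize ((Real.sinh X : ℝ) : ℂ) = x at *
    linear_combination 2 * pP * r * S ^ 2 * (h4 - h0) +
      2 * pP * r * S ^ 2 * pA * mP * z ^ M * z * (h θ ^ 2 - 1) * h5 +
      4 * r * S ^ 2 * pA * z * (h θ ^ 2 - 1) * ρ * ε * s₀ * h1 +
      2 * pA * ρ * ε * s₀ * w ^ M * T * h7 - 2 * pA * ρ * ε * s₀ * w ^ M * h θ * x * h2 -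
      2 * ρ * ε * w ^ M * h θ * x * h6 - 4 * h θ * pP * r * S * ε * η * hκ3
  · intro θ z hz
    obtain ⟨h1, h2⟩ := hprod θ z hz
    obtain ⟨h3, h4⟩ := hbase θ z hz
    have h5 := congrArg Complex.ofReal (hγ.exp_mul_sub_one_mul θ φ)
    have h6 := hh.one_sub_sq_sq_mul hγ θ
    have h7 := hγ.prod_two_sinh_mul (fun i => angP (2 * M + 2) (i + 1)) M θ z
    have h8 := hγ.prod_two_sinh_mul (fun i => angA (2 * M + 2) i) M θ z
    have hA := hAz θ z hz
    have hP := hPz θ z hz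
    have hκ3 := congrArg Complex.ofReal hκ2
    rw [← hz] at h6
    rw [prod_range_succ, ← hφ] at hA
    rw [h1, h2, h3, h4]
    rw [← hw] at h7 h8
    generalize ∏ i ∈ range M, (z * (2 * Real.cos θ - 2 * Real.cos (angP (2 * M + 2) (i + 1)) : ℝ)) =
      TP at *
    generalize ∏ i ∈ range M, (z * (2 * Real.cos θ - 2 * Real.cos (angA (2 * M + 2) i) : ℝ)) =
      TA at *
    generalize ∏ i ∈ range M, (2 * Real.sinh ((γ θ + γ (angA (2 * M + 2) i)) / 2)) = pA at *
    generalize ∏ i ∈ range M, (2 * Real.sinh ((γ θ - γ (angA (2 * M + 2) i)) / 2)) = mA at *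
    generalize ∏ i ∈ range M, (2 * Real.sinh ((γ θ + γ (angP (2 * M + 2) (i + 1))) / 2)) = pP at *
    generalize ∏ i ∈ range M, (2 * Real.sinh ((γ θ - γ (angP (2 * M + 2) (i + 1))) / 2)) = mP at *
    simp only [Complex.ofReal_mul, Complex.ofReal_pow] at *
    generalize z ^ (2 * M + 2) = zN at *
    generalize ((Real.exp (γ φ) * Real.exp (γ θ) - 1 : ℝ) : ℂ) = E at *
    generalize ((Real.exp (γ φ) * Real.exp (-γ θ) - 1 : ℝ) : ℂ) = E' at *
    generalize ((2 * Real.cos θ - 2 * Real.cos φ : ℝ) : ℂ) = c at *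
    generalize ((Real.sinh (γ θ) : ℝ) : ℂ) = s at *
    generalize ((Real.exp (γ φ) : ℝ) : ℂ) = a₀ at *
    generalize ((Real.sinh X : ℝ) : ℂ) = x at *
    generalize ((Real.sinh Y : ℝ) : ℂ) = y at *
    generalize h θ ^ 2 = b at *
    have q : pA * mA * z ^ M * (pP * mP * z ^ M) = w ^ M * TA * (w ^ M * TP) := by rw [h7, h8]
    have hAP : TA * (z * c) * ((z ^ 2 - 1) * TP) = (zN + 1) * (zN - 1) := by rw [hA, hP]
    linear_combination s * z ^ 2 * E * E' * (1 - b ^ 2) * q +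
      s * (w ^ M) ^ 2 * TA * TP * z ^ 2 * (1 - b ^ 2) * h5 +
      (w ^ M) ^ 2 * TA * TP * z * a₀ * x * y * c * h6 +
      (w ^ M) ^ 2 * a₀ * x ^ 2 * y * b * hAP - b * (zN ^ 2 - 1) * hκ3

theorem exists_isInterpolant (hγ : IsDispersion X Y γ) (hh : IsSymbRoot X Y γ h) {N : ℕ}
    (hN : 1 ≤ N) : ∃ U V κ, IsInterpolant X Y γ h N U V κ := by
  obtain ⟨M, hM⟩ := N.even_or_odd'
  rcases hM with rfl | rfl
  · obtain ⟨M, rfl⟩ : ∃ K, M = K + 1 := ⟨M - 1, by omega⟩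
    exact exists_isInterpolant_even hγ hh M
  · exact exists_isInterpolant_odd hγ hh M

end

theorem exp_angA_injective {N : ℕ} (hN : N ≠ 0) :
    Function.Injective fun j : Fin N => Complex.exp (Complex.I * (angA N j : ℝ)) := by
  intro i j hij
  have hN' : (N : ℝ) ≠ 0 := Nat.cast_ne_zero.2 hN
  obtain ⟨n, hn⟩ := Complex.exp_eq_exp_iff_exists_int.1 hij
  have h1 : angA N i = angA N j + n * (2 * Real.pi) := by
    have : Complex.I * (angA N i : ℝ) = Complex.I * ((angA N j + n * (2 * Real.pi) : ℝ) : ℂ) := by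
      rw [hn]; push_cast; ring
    exact_mod_cast mul_left_cancel₀ Complex.I_ne_zero this
  unfold angA at h1
  have h2 : ((i : ℕ) : ℝ) = (j : ℕ) + n * N := by
    field_simp at h1
    linarith
  have h3 : ((i : ℕ) : ℤ) = (j : ℕ) + n * N := by exact_mod_cast h2
  have hi := i.2
  have hj := j.2
  have h4 := congrArg (· % (N : ℤ)) h3
  simp only [Int.add_mul_emod_self_right] at h4
  rw [Int.emod_eq_of_lt (by omega) (by omega), Int.emod_eq_of_lt (by omega) (by omega)] at h4
  exact Fin.ext (by exact_mod_cast h4)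

/-- Lagrange interpolation at the `N`-th roots of `-1`. -/
theorem sum_eval_div_sub {N : ℕ} (hN : N ≠ 0) {G : Polynomial ℂ} (hG : G.degree < N) {ζ : ℂ}
    (hζ : ζ ^ N ≠ -1) :
    ∑ j : Fin N, Complex.exp (Complex.I * (angA N j : ℝ)) *
        G.eval (Complex.exp (Complex.I * (angA N j : ℝ))) /
        (Complex.exp (Complex.I * (angA N j : ℝ)) - ζ) =
      N * G.eval ζ / (ζ ^ N + 1) := by
  have hinj := (exp_angA_injective hN).injOn (s := ((univ : Finset (Fin N)) : Set (Fin N)))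
  set a : Fin N → ℂ := fun j => Complex.exp (Complex.I * (angA N j : ℝ)) with ha
  have hnodal : Lagrange.nodal univ a = Polynomial.X ^ N + 1 := by
    refine Polynomial.funext fun z => ?_
    rw [Lagrange.eval_nodal]
    simp only [Polynomial.eval_add, Polynomial.eval_pow, Polynomial.eval_X, Polynomial.eval_one]
    rw [← prod_sub_exp_angA hN, Finset.prod_range]
  have haN (j : Fin N) : a j ^ N = -1 := exp_angA_pow hN _
  have ha0 (j : Fin N) : a j ≠ 0 := Complex.exp_ne_zero _
  have hNC : (N : ℂ) ≠ 0 := Nat.cast_ne_zero.2 hN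
  have hw (j : Fin N) : Lagrange.nodalWeight univ a j = -(a j / N) := by
    rw [Lagrange.nodalWeight_eq_eval_derivative_nodal (mem_univ _), hnodal]
    simp only [Polynomial.derivative_add, Polynomial.derivative_X_pow, Polynomial.derivative_one,
      add_zero, Polynomial.eval_mul, Polynomial.eval_pow, Polynomial.eval_X, Polynomial.eval_C]
    have h1 : a j ^ (N - 1) * a j = -1 := by rw [← pow_succ, Nat.sub_add_cancel (by omega), haN]
    rw [eq_neg_of_add_eq_zero_left (a := a j ^ (N - 1)) (b := (a j)⁻¹)]
    · field_simp
    · have := ha0 j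
      field_simp
      rw [h1]; ring
  have hζ1 : ζ ^ N + 1 ≠ 0 := fun h => hζ (eq_neg_of_add_eq_zero_left h)
  have hne (j : Fin N) : ζ ≠ a j := fun h => hζ (h ▸ haN j)
  have hkey := congrArg (Polynomial.eval ζ) (Lagrange.eq_interpolate hinj
    (by simpa using hG : G.degree < (#(univ : Finset (Fin N)) : ℕ)))
  rw [Lagrange.eval_interpolate_not_at_node _ (fun j _ => hne j), hnodal] at hkey
  rw [hkey, eq_div_iff hζ1, sum_mul, mul_sum, mul_sum]
  refine sum_congr rfl fun j _ => ?_
  have h1 : ζ - a j ≠ 0 := sub_ne_zero.2 (hne j)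
  have h2 : a j - ζ ≠ 0 := sub_ne_zero.2 (hne j).symm
  change a j * G.eval (a j) / (a j - ζ) * (ζ ^ N + 1) = _
  rw [hw]
  simp only [Polynomial.eval_add, Polynomial.eval_pow, Polynomial.eval_X, Polynomial.eval_one]
  field_simp
  ring

section

variable {X Y : ℝ} {γ : ℝ → ℝ} {h : ℝ → ℂ}

theorem exists_eq_X_mul_X_sub_C_mul {N : ℕ} {H : Polynomial ℂ} (hd : H.natDegree ≤ N + 2)
    (ht : H.coeff (N + 2) = 0) (hb : H.coeff 0 = 0) {z₀ : ℂ} (hz₀ : z₀ ≠ 0) (hr : H.eval z₀ = 0) :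
    ∃ G : Polynomial ℂ, G.degree < N ∧
      H = Polynomial.X * ((Polynomial.X - Polynomial.C z₀) * G) := by
  obtain ⟨H', rfl⟩ := Polynomial.X_dvd_iff.2 hb
  have hr' : H'.IsRoot z₀ := by
    simpa [hz₀] using hr
  obtain ⟨G, rfl⟩ := Polynomial.dvd_iff_isRoot.2 hr'
  refine ⟨G, ?_, rfl⟩
  rcases eq_or_ne G 0 with rfl | hG
  · simp
  have h1 : (Polynomial.X - Polynomial.C z₀) ≠ 0 := Polynomial.X_sub_C_ne_zero z₀
  have h2 : (Polynomial.X * ((Polynomial.X - Polynomial.C z₀) * G)).natDegree =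
      G.natDegree + 2 := by
    rw [Polynomial.natDegree_mul Polynomial.X_ne_zero (mul_ne_zero h1 hG),
      Polynomial.natDegree_mul h1 hG, Polynomial.natDegree_X, Polynomial.natDegree_X_sub_C]
    ring
  have h3 : (Polynomial.X * ((Polynomial.X - Polynomial.C z₀) * G)) ≠ 0 :=
    mul_ne_zero Polynomial.X_ne_zero (mul_ne_zero h1 hG)
  rw [Polynomial.degree_eq_natDegree hG, Nat.cast_lt]
  by_contra hlt
  have h4 : (Polynomial.X * ((Polynomial.X - Polynomial.C z₀) * G)).natDegree = N + 2 := by omega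
  rw [← h4] at ht
  exact h3 (Polynomial.leadingCoeff_eq_zero.1 ht)

/-- The division of the interpolation test polynomial by its trivial factors. -/
theorem IsInterpolant.exists_quotient {N : ℕ} {U V : Polynomial ℂ} {κ : ℝ}
    (hI : IsInterpolant X Y γ h N U V κ) (hγ : IsDispersion X Y γ) (hh : IsSymbRoot X Y γ h)
    {θ₀ : ℝ} (hθ₀ : Complex.exp (Complex.I * θ₀) ^ N = 1) (ω : ℝ) :
    ∃ G : Polynomial ℂ, G.degree < N ∧ ∀ (θ : ℝ) (z : ℂ), z = Complex.exp (Complex.I * θ) →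
      (z - Complex.exp (Complex.I * θ₀)) * G.eval z =
        V.eval z * (Real.cosh (γ θ) - ω : ℝ) - U.eval z * (h θ ^ 2 * Real.sinh (γ θ)) +
        h θ₀ ^ 2 * (U.eval z * (Real.cosh (γ θ) - ω : ℝ) -
          V.eval z * (h θ ^ 2)⁻¹ * Real.sinh (γ θ)) := by
  set H := V * (coshPoly X Y - Polynomial.C (ω : ℂ) * Polynomial.X) - U * symbPoly X Y +
    Polynomial.C (h θ₀ ^ 2) * (U * (coshPoly X Y - Polynomial.C (ω : ℂ) * Polynomial.X) -
      V * symbPolyNeg X Y) with hH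
  have hev (θ : ℝ) (z : ℂ) (hz : z = Complex.exp (Complex.I * θ)) : H.eval z =
      z * (V.eval z * (Real.cosh (γ θ) - ω : ℝ) - U.eval z * (h θ ^ 2 * Real.sinh (γ θ)) +
        h θ₀ ^ 2 * (U.eval z * (Real.cosh (γ θ) - ω : ℝ) -
          V.eval z * (h θ ^ 2)⁻¹ * Real.sinh (γ θ))) := by
    have h1 := hh.eval_symbPoly θ
    have h2 := hh.eval_symbPolyNeg hγ θ
    have h3 := hγ.eval_coshPoly θ
    rw [← hz] at h1 h2 h3
    have h0 : h θ ^ 2 ≠ 0 := pow_ne_zero _ (hh.ne_zero θ)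
    have h2' : (symbPolyNeg X Y).eval z = z * ((h θ ^ 2)⁻¹ * Real.sinh (γ θ)) := by
      apply mul_left_cancel₀ h0
      rw [h2, mul_left_comm, mul_inv_cancel_left₀ h0]
    simp only [hH, Polynomial.eval_add, Polynomial.eval_sub, Polynomial.eval_mul,
      Polynomial.eval_C, Polynomial.eval_X, h1, h2', h3, Complex.ofReal_sub]
    ring
  have d1 : (coshPoly X Y - Polynomial.C (ω : ℂ) * Polynomial.X).natDegree ≤ 2 := by
    refine (Polynomial.natDegree_sub_le _ _).trans (max_le (natDegree_realQuad_le _ _ _) ?_)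
    exact (Polynomial.natDegree_C_mul_le _ _).trans (Polynomial.natDegree_X_le.trans one_le_two)
  have d2 : (symbPoly X Y).natDegree ≤ 2 := natDegree_realQuad_le _ _ _
  have d3 : (symbPolyNeg X Y).natDegree ≤ 2 := natDegree_realQuad_le _ _ _
  have hU := hI.admissible.left_le
  have hV := hI.admissible.right_le
  have hsq : (Real.sinh Y : ℂ) ^ 2 = (Real.cosh Y - 1) * (Real.cosh Y + 1) := by
    have h2 : Real.sinh Y ^ 2 = (Real.cosh Y - 1) * (Real.cosh Y + 1) := by
      rw [Real.sinh_sq]; ring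
    exact_mod_cast h2
  have hs : (Real.sinh Y : ℂ) ≠ 0 := Complex.ofReal_ne_zero.2 hγ.sinh_right_pos.ne'
  have ht := hI.admissible.top
  have hb := hI.admissible.bot
  obtain ⟨G, hG, hHG⟩ := exists_eq_X_mul_X_sub_C_mul (N := N) (H := H)
    (z₀ := Complex.exp (Complex.I * θ₀))
    (by
      refine Polynomial.natDegree_add_le_of_degree_le ?_
        ((Polynomial.natDegree_C_mul_le _ _).trans ?_)
      · exact (Polynomial.natDegree_sub_le _ _).trans (max_le
          (Polynomial.natDegree_mul_le_of_le hV d1) (Polynomial.natDegree_mul_le_of_le hU d2))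
      · exact (Polynomial.natDegree_sub_le _ _).trans (max_le
          (Polynomial.natDegree_mul_le_of_le hU d1) (Polynomial.natDegree_mul_le_of_le hV d3)))
    (by
      rw [hH, Polynomial.coeff_add, Polynomial.coeff_C_mul, Polynomial.coeff_sub,
        Polynomial.coeff_sub, Polynomial.coeff_mul_add_eq_of_natDegree_le hV d1,
        Polynomial.coeff_mul_add_eq_of_natDegree_le hU d1,
        Polynomial.coeff_mul_add_eq_of_natDegree_le hU d2,
        Polynomial.coeff_mul_add_eq_of_natDegree_le hV d3]
      simp only [Polynomial.coeff_sub, Polynomial.coeff_C_mul, coshPoly, symbPoly, symbPolyNeg,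
        coeff_two_realQuad, Polynomial.coeff_X_of_ne_one (by norm_num : (2 : ℕ) ≠ 1)]
      apply mul_left_cancel₀ hs
      push_cast at ht hsq ⊢
      linear_combination (-(Complex.sinh Y) * Complex.sinh X / 2) * ht +
        h θ₀ ^ 2 * Complex.sinh X / 2 * ((Complex.cosh Y - 1) * ht - U.coeff N * hsq))
    (by
      rw [hH, Polynomial.coeff_add, Polynomial.coeff_C_mul, Polynomial.coeff_sub,
        Polynomial.coeff_sub]
      simp only [Polynomial.coeff_sub, Polynomial.mul_coeff_zero, coshPoly,
        symbPoly, symbPolyNeg, coeff_zero_realQuad, Polynomial.coeff_X_zero]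
      apply mul_left_cancel₀ hs
      push_cast at hb hsq ⊢
      linear_combination (-(Complex.sinh Y) * Complex.sinh X / 2) * hb +
        h θ₀ ^ 2 * Complex.sinh X / 2 * ((Complex.cosh Y + 1) * hb - U.coeff 0 * hsq))
    (Complex.exp_ne_zero _)
    (by
      rw [hev θ₀ _ rfl, eq_neg_of_add_eq_zero_right (hI.periodic θ₀ _ rfl hθ₀)]
      have h0 : h θ₀ ≠ 0 := hh.ne_zero θ₀
      field_simp
      ring)
  refine ⟨G, hG, fun θ z hz => ?_⟩
  have hz0 : z ≠ 0 := hz ▸ Complex.exp_ne_zero _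
  have h1 := hev θ z hz
  rw [hHG] at h1
  simp only [Polynomial.eval_mul, Polynomial.eval_sub, Polynomial.eval_X, Polynomial.eval_C] at h1
  exact mul_left_cancel₀ hz0 h1

end

theorem exp_I_mul_eq_sq (a : ℝ) :
    Complex.exp (Complex.I * a) = Complex.exp (Complex.I * (a / 2 : ℝ)) ^ 2 := by
  rw [← Complex.exp_nat_mul]
  congr 1
  push_cast
  ring

theorem exp_I_mul_sub_exp_I_mul (a b : ℝ) :
    Complex.exp (Complex.I * a) - Complex.exp (Complex.I * b) =
      Complex.exp (Complex.I * (a / 2 : ℝ)) * Complex.exp (Complex.I * (b / 2 : ℝ)) *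
        (2 * Complex.I * (Real.sin ((a - b) / 2) : ℝ)) := by
  have h1 := exp_mul_two_I_sin ((a - b) / 2)
  have h2 : Complex.exp (Complex.I * (a / 2 : ℝ)) =
      Complex.exp (Complex.I * (b / 2 : ℝ)) * Complex.exp (Complex.I * ((a - b) / 2 : ℝ)) := by
    rw [← Complex.exp_add]
    congr 1
    push_cast
    ring
  rw [exp_I_mul_eq_sq a, exp_I_mul_eq_sq b, h2]
  linear_combination -Complex.exp (Complex.I * (b / 2 : ℝ)) ^ 2 * h1

theorem sin_half_sub_ne_zero {a b : ℝ}
    (hab : Complex.exp (Complex.I * a) ≠ Complex.exp (Complex.I * b)) :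
    ((Real.sin ((a - b) / 2) : ℝ) : ℂ) ≠ 0 := by
  intro h
  apply hab
  rw [← sub_eq_zero, exp_I_mul_sub_exp_I_mul, h, mul_zero, mul_zero]

/-- The positive weight `(√b_φ/√b_θ + √b_θ/√b_φ) e^{ν_φ/2} / √(sinh γ_φ)`. -/
def pairWeight (N : ℕ) (γ : ℝ → ℝ) (h : ℝ → ℂ) (θ φ : ℝ) : ℂ :=
  (h φ / h θ + h θ / h φ) * (Real.exp (nufun N γ φ / 2) : ℝ) / (Real.sqrt (Real.sinh (γ φ)) : ℝ)

section

variable {X Y : ℝ} {γ : ℝ → ℝ} {h : ℝ → ℂ} {N : ℕ} {U V : Polynomial ℂ} {κ : ℝ}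

theorem exists_pairWeight_eq (hγ : IsDispersion X Y γ) (hh : IsSymbRoot X Y γ h) (N : ℕ)
    (θ φ : ℝ) : ∃ r : ℝ, 0 < r ∧ pairWeight N γ h θ φ = r := by
  obtain ⟨r, hr, he⟩ := hh.mul_inv_add_mul_inv_re_pos hγ φ θ
  refine ⟨r * Real.exp (nufun N γ φ / 2) / Real.sqrt (Real.sinh (γ φ)),
    div_pos (mul_pos hr (Real.exp_pos _)) (Real.sqrt_pos.2 (hγ.sinh_pos _)), ?_⟩
  rw [pairWeight, he]
  push_cast
  rfl

theorem IsInterpolant.sum_pairWeight_mul_sinh (hI : IsInterpolant X Y γ h N U V κ) (hN : N ≠ 0)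
    (hh : IsSymbRoot X Y γ h) (hγ : IsDispersion X Y γ)
    {θ₀ φ : ℝ} (hθ₀ : Complex.exp (Complex.I * θ₀) ^ N = 1)
    (hφ : Complex.exp (Complex.I * φ) ^ N ≠ -1) (u : ℝ) {G : Polynomial ℂ} (hG : G.degree < N)
    (hGe : ∀ (θ : ℝ) (z : ℂ), z = Complex.exp (Complex.I * θ) →
      (z - Complex.exp (Complex.I * θ₀)) * G.eval z =
        V.eval z * (Real.cosh (γ θ) - Real.exp u : ℝ) -
        U.eval z * (h θ ^ 2 * Real.sinh (γ θ)) +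
        h θ₀ ^ 2 * (U.eval z * (Real.cosh (γ θ) - Real.exp u : ℝ) -
          V.eval z * (h θ ^ 2)⁻¹ * Real.sinh (γ θ))) :
    κ * h θ₀ * (Real.exp (u / 2) : ℝ) * (Complex.exp (Complex.I * φ) ^ N + 1) *
      ∑ j : Fin N, pairWeight N γ h θ₀ (angA N j) *
        (Real.sinh ((γ (angA N j) + u) / 2) : ℝ) /
        ((Real.sin ((angA N j - θ₀) / 2) : ℝ) * (Real.sin ((angA N j - φ) / 2) : ℝ)) =
      2 * N * Complex.exp (Complex.I * (θ₀ / 2 : ℝ)) * Complex.exp (Complex.I * (φ / 2 : ℝ)) *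
        G.eval (Complex.exp (Complex.I * φ)) := by
  have hL := sum_eval_div_sub hN hG hφ
  have hφ1 : Complex.exp (Complex.I * φ) ^ N + 1 ≠ 0 :=
    fun h => hφ (eq_neg_of_add_eq_zero_left h)
  have hq0 : Complex.exp (Complex.I * (θ₀ / 2 : ℝ)) ≠ 0 := Complex.exp_ne_zero _
  have hqφ : Complex.exp (Complex.I * (φ / 2 : ℝ)) ≠ 0 := Complex.exp_ne_zero _
  have hterm (j : Fin N) : Complex.exp (Complex.I * (angA N j : ℝ)) *
      G.eval (Complex.exp (Complex.I * (angA N j : ℝ))) /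
        (Complex.exp (Complex.I * (angA N j : ℝ)) - Complex.exp (Complex.I * φ)) =
      κ * h θ₀ * (Real.exp (u / 2) : ℝ) / (2 * (Complex.exp (Complex.I * (θ₀ / 2 : ℝ)) *
        Complex.exp (Complex.I * (φ / 2 : ℝ)))) * (pairWeight N γ h θ₀ (angA N j) *
        (Real.sinh ((γ (angA N j) + u) / 2) : ℝ) /
        ((Real.sin ((angA N j - θ₀) / 2) : ℝ) * (Real.sin ((angA N j - φ) / 2) : ℝ))) := by
    set A := angA N j
    have hAN : Complex.exp (Complex.I * A) ^ N = -1 := exp_angA_pow hN j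
    have hA0 : Complex.exp (Complex.I * A) ≠ Complex.exp (Complex.I * θ₀) := by
      intro h
      rw [h, hθ₀] at hAN
      norm_num at hAN
    have hAφ : Complex.exp (Complex.I * A) ≠ Complex.exp (Complex.I * φ) :=
      fun h => hφ (h ▸ hAN)
    have hS0 := sin_half_sub_ne_zero hA0
    have hSφ := sin_half_sub_ne_zero hAφ
    have h1 := hGe A _ rfl
    have h2 := eq_of_sub_eq_zero (a := V.eval (Complex.exp (Complex.I * A)))
      (by rw [sub_eq_neg_add]; exact hI.antiperiodic A _ rfl hAN)
    have h3 := hI.value A _ rfl hAN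
    have h4 := exp_I_mul_sub_exp_I_mul A θ₀
    have h5 := exp_I_mul_sub_exp_I_mul A φ
    have h6 := exp_I_mul_eq_sq A
    have h7 := congrArg Complex.ofReal (Real.exp_sub_exp (-γ A) u)
    have h8 : Real.sinh ((-γ A - u) / 2) = -Real.sinh ((γ A + u) / 2) := by
      rw [← Real.sinh_neg]; ring_nf
    have h9 : Real.cosh (γ A) - Real.exp u = Real.exp (-γ A) - Real.exp u + Real.sinh (γ A) := by
      rw [Real.cosh_eq, Real.sinh_eq]; ring
    have h10 : (Real.exp (γ A / 2) : ℂ) * (Real.exp (-γ A / 2) : ℝ) = 1 := by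
      rw [← Complex.ofReal_mul, ← Real.exp_add]; simp [neg_div]
    have hp : Complex.exp (Complex.I * (A / 2 : ℝ)) ≠ 0 := Complex.exp_ne_zero _
    have hs0 : ((Real.sqrt (Real.sinh (γ A)) : ℝ) : ℂ) ≠ 0 :=
      Complex.ofReal_ne_zero.2 (Real.sqrt_pos.2 (hγ.sinh_pos _)).ne'
    have hh0 := hh.ne_zero A
    have hh1 := hh.ne_zero θ₀
    rw [h8] at h7
    rw [h9, h2, h4] at h1
    rw [pairWeight, h5, h6]
    rw [h6] at h1 h3
    generalize Polynomial.eval (Complex.exp (Complex.I * (A / 2 : ℝ)) ^ 2) G = g at *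
    generalize Polynomial.eval (Complex.exp (Complex.I * (A / 2 : ℝ)) ^ 2) U = v at *
    generalize Complex.exp (Complex.I * (A / 2 : ℝ)) = p at *
    generalize Complex.exp (Complex.I * (θ₀ / 2 : ℝ)) = q₀ at *
    generalize Complex.exp (Complex.I * (φ / 2 : ℝ)) = q at *
    rw [Complex.ofReal_add, h7] at h1
    have hinv := mul_inv_cancel₀ (pow_ne_zero 2 hh0)
    simp only [Complex.ofReal_mul, Complex.ofReal_neg, Complex.ofReal_ofNat] at h1
    generalize ((Real.sinh ((γ A + u) / 2) : ℝ) : ℂ) = sh at *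
    generalize ((Real.sinh (γ A) : ℝ) : ℂ) = s at *
    generalize ((Real.sqrt (Real.sinh (γ A)) : ℝ) : ℂ) = t at *
    generalize ((Real.exp (γ A / 2) : ℝ) : ℂ) = a at *
    generalize ((Real.exp (-γ A / 2) : ℝ) : ℂ) = a' at *
    generalize ((Real.exp (u / 2) : ℝ) : ℂ) = e at *
    generalize ((Real.exp (nufun N γ A / 2) : ℝ) : ℂ) = η at *
    generalize ((Real.sin ((A - θ₀) / 2) : ℝ) : ℂ) = S₀ at *
    generalize ((Real.sin ((A - φ) / 2) : ℝ) : ℂ) = S at *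
    generalize h A = k at *
    generalize h θ₀ = k₀ at *
    have hg : g = κ * η * (k ^ 2 + k₀ ^ 2) * e * (sh * Complex.I) / (k * t * p * q₀ * S₀) := by
      rw [eq_div_iff (by simp [*])]
      linear_combination (-Complex.I / 2 * k * t) * h1 +
        Complex.I * (k ^ 2 + k₀ ^ 2) * e * a' * sh * h3 +
        Complex.I * κ * η * (k ^ 2 + k₀ ^ 2) * e * sh * h10 +
        p * q₀ * S₀ * g * k * t * Complex.I_sq + Complex.I / 2 * k * t * k₀ ^ 2 * v * s * hinv
    rw [hg, div_eq_iff (by simp [*])]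
    field_simp
  rw [sum_congr rfl fun j _ => hterm j, ← mul_sum, eq_div_iff hφ1] at hL
  generalize (∑ j : Fin N, pairWeight N γ h θ₀ (angA N j) *
        (Real.sinh ((γ (angA N j) + u) / 2) : ℝ) /
        ((Real.sin ((angA N j - θ₀) / 2) : ℝ) * (Real.sin ((angA N j - φ) / 2) : ℝ))) = S at *
  field_simp at hL
  linear_combination hL

end

theorem IsDispersion.nufun_neg {X Y : ℝ} {γ : ℝ → ℝ} (hγ : IsDispersion X Y γ) (N : ℕ) (θ : ℝ) :
    nufun N γ (-θ) = nufun N γ θ := by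
  simp only [nufun, hγ.neg]

theorem continuous_eq_of_exp_pow_ne {N : ℕ} (hN : N ≠ 0) {f g : ℝ → ℂ} (hf : Continuous f)
    (hg : Continuous g)
    (hfg : ∀ θ : ℝ, (Complex.exp (Complex.I * θ) ^ N) ^ 2 ≠ 1 → f θ = g θ) (θ : ℝ) :
    f θ = g θ := by
  have hd : HasDerivAt (fun t : ℝ => (Complex.exp (Complex.I * t) ^ N) ^ 2)
      (Complex.exp ((2 * N : ℂ) * (Complex.I * θ)) * ((2 * N : ℂ) * Complex.I)) θ := by
    have h1 : HasDerivAt (fun t : ℝ => (2 * N : ℂ) * (Complex.I * t)) ((2 * N : ℂ) * Complex.I)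
        θ := by
      simpa using
        ((Complex.ofRealCLM.hasDerivAt (x := θ)).const_mul Complex.I).const_mul (2 * N : ℂ)
    convert h1.cexp using 2 with t
    rw [← pow_mul, ← Complex.exp_nat_mul]
    push_cast
    ring_nf
  have hne : Complex.exp ((2 * N : ℂ) * (Complex.I * θ)) * ((2 * N : ℂ) * Complex.I) ≠ 0 := by
    have : (N : ℂ) ≠ 0 := Nat.cast_ne_zero.2 hN
    simp [this]
  have hev := hd.eventually_ne hne (c := 1)
  exact tendsto_nhds_unique_of_eventuallyEq (l := nhdsWithin θ {θ}ᶜ)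
    (hf.continuousAt.tendsto.mono_left nhdsWithin_le_nhds)
    (hg.continuousAt.tendsto.mono_left nhdsWithin_le_nhds) (hev.mono hfg)

section

variable {X Y : ℝ} {γ : ℝ → ℝ} {h : ℝ → ℂ} {N : ℕ} {U V : Polynomial ℂ} {κ : ℝ}

theorem IsSymbRoot.continuous_sq (hγ : IsDispersion X Y γ) (hh : IsSymbRoot X Y γ h) :
    Continuous fun θ => h θ ^ 2 := by
  have h1 : (fun θ => h θ ^ 2) = fun θ => symb X Y θ / (Real.sinh (γ θ) : ℝ) := by
    funext θ
    rw [eq_div_iff (Complex.ofReal_ne_zero.2 (hγ.sinh_pos θ).ne'), hh.sq_mul]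
  rw [h1]
  refine Continuous.div ?_ ?_ fun θ => Complex.ofReal_ne_zero.2 (hγ.sinh_pos θ).ne'
  · unfold symb
    fun_prop
  · exact Complex.continuous_ofReal.comp (Real.continuous_sinh.comp hγ.continuous)

theorem IsInterpolant.sum_pairWeight_eq_zero (hI : IsInterpolant X Y γ h N U V κ) (hN : N ≠ 0)
    (hh : IsSymbRoot X Y γ h) (hγ : IsDispersion X Y γ) {θ₀ θ₁ : ℝ}
    (hθ₀ : Complex.exp (Complex.I * θ₀) ^ N = 1) (hθ₁ : Complex.exp (Complex.I * θ₁) ^ N = 1)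
    (hne : Complex.exp (Complex.I * θ₁) ≠ Complex.exp (Complex.I * θ₀)) :
    ∑ j : Fin N, pairWeight N γ h θ₀ (angA N j) *
        (Real.sinh ((γ (angA N j) + γ θ₁) / 2) : ℝ) /
        ((Real.sin ((angA N j - θ₀) / 2) : ℝ) * (Real.sin ((angA N j - θ₁) / 2) : ℝ)) = 0 := by
  obtain ⟨G, hG, hGe⟩ := hI.exists_quotient hγ hh hθ₀ (Real.exp (γ θ₁))
  have h1 := hI.sum_pairWeight_mul_sinh hN hh hγ hθ₀ (φ := θ₁) (by rw [hθ₁]; norm_num) (γ θ₁) hG hGe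
  have h2 := hGe θ₁ _ rfl
  have hh1 := hh.ne_zero θ₁
  have h3 : Real.cosh (γ θ₁) - Real.exp (γ θ₁) = -Real.sinh (γ θ₁) := by
    rw [Real.cosh_eq, Real.sinh_eq]; ring
  rw [eq_neg_of_add_eq_zero_right (hI.periodic θ₁ _ rfl hθ₁), h3] at h2
  have h4 : (Complex.exp (Complex.I * θ₁) - Complex.exp (Complex.I * θ₀)) *
      G.eval (Complex.exp (Complex.I * θ₁)) = 0 := by
    rw [h2, Complex.ofReal_neg]
    field_simp
    ring
  rw [(mul_eq_zero.1 h4).resolve_left (sub_ne_zero.2 hne), mul_zero, hθ₁] at h1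
  refine (mul_eq_zero.1 h1).resolve_left ?_
  have := hI.ne_zero
  have := hh.ne_zero θ₀
  have : ((Real.exp (γ θ₁ / 2) : ℝ) : ℂ) ≠ 0 := Complex.ofReal_ne_zero.2 (Real.exp_pos _).ne'
  have : (1 + 1 : ℂ) ≠ 0 := by norm_num
  simp [*]

/-- The sum over antiperiodic momenta obtained by commuting past the pole at `φ`. -/
def sinSum (N : ℕ) (γ : ℝ → ℝ) (h : ℝ → ℂ) (θ₀ φ : ℝ) : ℂ :=
  ∑ j : Fin N, pairWeight N γ h θ₀ (angA N j) * (Real.sin ((angA N j + φ) / 2) : ℝ) /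
    ((Real.sin ((angA N j - θ₀) / 2) : ℝ) * (Real.sinh ((γ (angA N j) + γ φ) / 2) : ℝ))

theorem continuous_sinSum (hγ : IsDispersion X Y γ) {θ₀ : ℝ}
    (hθ₀ : ∀ j : Fin N, ((Real.sin ((angA N j - θ₀) / 2) : ℝ) : ℂ) ≠ 0) :
    Continuous (sinSum N γ h θ₀) := by
  have hγc := hγ.continuous
  unfold sinSum
  refine continuous_finsetSum _ fun j _ => Continuous.div ?_ ?_ fun φ =>
    mul_ne_zero (hθ₀ j) (Complex.ofReal_ne_zero.2 (hγ.half_sinh_pos _ _).ne')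
  · refine continuous_const.mul (Complex.continuous_ofReal.comp ?_)
    fun_prop
  · refine continuous_const.mul (Complex.continuous_ofReal.comp (Real.continuous_sinh.comp ?_))
    fun_prop

theorem sin_half_sub_angA_ne_zero (hN : N ≠ 0) {θ₀ : ℝ}
    (hθ₀ : Complex.exp (Complex.I * θ₀) ^ N = 1) (j : ℕ) :
    ((Real.sin ((angA N j - θ₀) / 2) : ℝ) : ℂ) ≠ 0 := by
  refine sin_half_sub_ne_zero fun h => ?_
  have := exp_angA_pow hN j
  rw [h, hθ₀] at this
  norm_num at this

theorem IsInterpolant.sinSum_mul_of_ne (hI : IsInterpolant X Y γ h N U V κ) (hN : N ≠ 0)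
    (hh : IsSymbRoot X Y γ h) (hγ : IsDispersion X Y γ) {θ₀ : ℝ}
    (hθ₀ : Complex.exp (Complex.I * θ₀) ^ N = 1) (φ : ℝ)
    (hφ : (Complex.exp (Complex.I * φ) ^ N) ^ 2 ≠ 1) :
    h θ₀ * (Real.exp (-γ φ / 2) : ℝ) * (Real.sinh X * Real.sinh Y : ℝ) * sinSum N γ h θ₀ φ *
        (Complex.exp (Complex.I * φ) - Complex.exp (Complex.I * θ₀)) *
        (U.eval (Complex.exp (Complex.I * φ)) * h φ ^ 2 + V.eval (Complex.exp (Complex.I * φ))) =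
      2 * N * κ * Complex.exp (Complex.I * (θ₀ / 2 : ℝ)) * Complex.exp (Complex.I * (φ / 2 : ℝ)) *
        (Complex.exp (Complex.I * φ) ^ N - 1) * (h φ ^ 2 - h θ₀ ^ 2) := by
  have hφ1 : Complex.exp (Complex.I * φ) ^ N ≠ -1 := fun h => hφ (by rw [h]; norm_num)
  obtain ⟨G, hG, hGe⟩ := hI.exists_quotient hγ hh hθ₀ (Real.exp (-γ φ))
  have h1 := hI.sum_pairWeight_mul_sinh hN hh hγ hθ₀ hφ1 (-γ φ) hG hGe
  have h2 := hGe φ _ rfl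
  have hhφ := hh.ne_zero φ
  have hκ : (κ : ℂ) ≠ 0 := Complex.ofReal_ne_zero.2 hI.ne_zero
  have h3 : Real.cosh (γ φ) - Real.exp (-γ φ) = Real.sinh (γ φ) := by
    rw [Real.cosh_eq, Real.sinh_eq]; ring
  have h4 := hI.norm φ _ rfl
  have hsum : ∑ j : Fin N, pairWeight N γ h θ₀ (angA N j) *
        (Real.sinh ((γ (angA N j) + -γ φ) / 2) : ℝ) /
        ((Real.sin ((angA N j - θ₀) / 2) : ℝ) * (Real.sin ((angA N j - φ) / 2) : ℝ)) =
      (Real.sinh X * Real.sinh Y : ℝ) * sinSum N γ h θ₀ φ := by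
    rw [sinSum, mul_sum]
    refine sum_congr rfl fun j _ => ?_
    have hA0 := sin_half_sub_angA_ne_zero hN hθ₀ j
    have hAφ : ((Real.sin ((angA N j - φ) / 2) : ℝ) : ℂ) ≠ 0 :=
      sin_half_sub_ne_zero fun h => hφ1 (h ▸ exp_angA_pow hN j)
    have hsh : ((Real.sinh ((γ (angA N j) + γ φ) / 2) : ℝ) : ℂ) ≠ 0 :=
      Complex.ofReal_ne_zero.2 (hγ.half_sinh_pos _ _).ne'
    have h5 : Real.sinh ((γ (angA N j) + -γ φ) / 2) * Real.sinh ((γ (angA N j) + γ φ) / 2) =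
        Real.sinh X * Real.sinh Y *
          (Real.sin ((angA N j + φ) / 2) * Real.sin ((angA N j - φ) / 2)) := by
      have h6 := hγ.two_sinh_mul_two_sinh (angA N j) φ
      have h7 := Real.cos_sub_cos φ (angA N j)
      rw [show (φ + angA N j) / 2 = (angA N j + φ) / 2 by ring,
        show (φ - angA N j) / 2 = -((angA N j - φ) / 2) by ring, Real.sin_neg] at h7
      rw [← sub_eq_add_neg]
      linear_combination h6 / 4 + Real.sinh X * Real.sinh Y / 2 * h7
    have h5' := congrArg Complex.ofReal h5
    rw [div_eq_iff (mul_ne_zero hA0 hAφ)]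
    field_simp
    simp only [Complex.ofReal_mul] at h5' ⊢
    linear_combination pairWeight N γ h θ₀ (angA N j) * h5'
  rw [hsum] at h1
  rw [h3] at h2
  have hφ2 : Complex.exp (Complex.I * φ) ^ N + 1 ≠ 0 := fun h => hφ1 (eq_neg_of_add_eq_zero_left h)
  generalize Complex.exp (Complex.I * φ) ^ N = zN at *
  generalize sinSum N γ h θ₀ φ = S at *
  generalize Complex.exp (Complex.I * φ) = z at *
  generalize Complex.exp (Complex.I * θ₀) = z₀ at *
  have hinv := mul_inv_cancel₀ (pow_ne_zero 2 hhφ)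
  have h2' : h φ ^ 2 * ((z - z₀) * G.eval z) =
      (Real.sinh (γ φ) : ℝ) * (V.eval z - U.eval z * h φ ^ 2) * (h φ ^ 2 - h θ₀ ^ 2) := by
    rw [h2]
    linear_combination -(h θ₀ ^ 2 * V.eval z * (Real.sinh (γ φ) : ℝ)) * hinv
  apply mul_left_cancel₀ (mul_ne_zero (mul_ne_zero hκ (pow_ne_zero 2 hhφ)) hφ2)
  generalize Complex.exp (Complex.I * (θ₀ / 2 : ℝ)) = q₀ at *
  generalize Complex.exp (Complex.I * (φ / 2 : ℝ)) = q at *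
  linear_combination h φ ^ 2 * (z - z₀) * (U.eval z * h φ ^ 2 + V.eval z) * h1 +
    2 * N * q₀ * q * (U.eval z * h φ ^ 2 + V.eval z) * h2' +
    2 * N * q₀ * q * (h φ ^ 2 - h θ₀ ^ 2) * h4

theorem IsInterpolant.sinSum_mul (hI : IsInterpolant X Y γ h N U V κ) (hN : N ≠ 0)
    (hh : IsSymbRoot X Y γ h) (hγ : IsDispersion X Y γ) {θ₀ : ℝ}
    (hθ₀ : Complex.exp (Complex.I * θ₀) ^ N = 1) (φ : ℝ) :
    h θ₀ * (Real.exp (-γ φ / 2) : ℝ) * (Real.sinh X * Real.sinh Y : ℝ) * sinSum N γ h θ₀ φ *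
        (Complex.exp (Complex.I * φ) - Complex.exp (Complex.I * θ₀)) *
        (U.eval (Complex.exp (Complex.I * φ)) * h φ ^ 2 + V.eval (Complex.exp (Complex.I * φ))) =
      2 * N * κ * Complex.exp (Complex.I * (θ₀ / 2 : ℝ)) * Complex.exp (Complex.I * (φ / 2 : ℝ)) *
        (Complex.exp (Complex.I * φ) ^ N - 1) * (h φ ^ 2 - h θ₀ ^ 2) := by
  have hS := continuous_sinSum (h := h) hγ fun j => sin_half_sub_angA_ne_zero hN hθ₀ j
  have hγc := hγ.continuous
  have hhc := hh.continuous_sq hγ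
  have hU := U.continuous
  have hV := V.continuous
  refine continuous_eq_of_exp_pow_ne hN ?_ ?_ (hI.sinSum_mul_of_ne hN hh hγ hθ₀) φ
  · fun_prop
  · fun_prop

/-- The sum that gives the entries of `C`. -/
theorem sum_pairWeight_mul_sin (hN : N ≠ 0) (hh : IsSymbRoot X Y γ h) (hγ : IsDispersion X Y γ)
    {θ₀ θ : ℝ} (hθ₀ : Complex.exp (Complex.I * θ₀) ^ N = 1)
    (hθ : Complex.exp (Complex.I * θ) ^ N = -1) :
    h θ₀ * h θ * (Real.sinh X * Real.sinh Y : ℝ) * (Real.exp (nufun N γ θ / 2) : ℝ) *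
        (Complex.I * (Real.sin ((θ₀ + θ) / 2) : ℝ)) * sinSum N γ h θ₀ (-θ) =
      N * (1 - h θ₀ ^ 2 * h θ ^ 2) * (Real.sqrt (Real.sinh (γ θ)) : ℝ) := by
  obtain ⟨U, V, κ, hI⟩ := exists_isInterpolant hγ hh (Nat.one_le_iff_ne_zero.2 hN)
  have hneg : Complex.exp (Complex.I * (-θ : ℝ)) ^ N = -1 := by
    rw [Complex.ofReal_neg, mul_neg, Complex.exp_neg, inv_pow, hθ]
    norm_num
  have h1 := hI.sinSum_mul hN hh hγ hθ₀ (-θ)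
  have h2 := eq_of_sub_eq_zero (a := V.eval (Complex.exp (Complex.I * (-θ : ℝ))))
      (by rw [sub_eq_neg_add]; exact hI.antiperiodic _ _ rfl hneg)
  have h3 := hI.value _ _ rfl hneg
  have h4 := exp_I_mul_sub_exp_I_mul (-θ) θ₀
  have h5 : Real.sin ((-θ - θ₀) / 2) = -Real.sin ((θ₀ + θ) / 2) := by
    rw [← Real.sin_neg]; ring_nf
  rw [h5] at h4
  rw [h2, hneg, h4] at h1
  rw [hγ.neg, hγ.nufun_neg] at h3
  have hκ : (κ : ℂ) ≠ 0 := Complex.ofReal_ne_zero.2 hI.ne_zero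
  have hhθ := hh.ne_zero θ
  have hh0 := hh.ne_zero θ₀
  have hinv := hh.apply_neg hγ θ
  have hinv' := mul_inv_cancel₀ hhθ
  rw [hγ.neg, hinv] at h1
  rw [hinv] at h3
  have hq₀ : Complex.exp (Complex.I * (θ₀ / 2 : ℝ)) ≠ 0 := Complex.exp_ne_zero _
  have hq : Complex.exp (Complex.I * (-θ / 2 : ℝ)) ≠ 0 := Complex.exp_ne_zero _
  have h10 : (Real.exp (γ θ / 2) : ℂ) * (Real.exp (-γ θ / 2) : ℝ) = 1 := by
    rw [← Complex.ofReal_mul, ← Real.exp_add]; simp [neg_div]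
  generalize Complex.exp (Complex.I * (θ₀ / 2 : ℝ)) = q₀ at *
  generalize Complex.exp (Complex.I * (-θ / 2 : ℝ)) = q at *
  generalize sinSum N γ h θ₀ (-θ) = S at *
  rw [Complex.ofReal_neg] at h1
  have hinv2 : (h θ)⁻¹ ^ 2 * h θ ^ 2 = 1 := by
    rw [← mul_pow, inv_mul_cancel₀ hhθ, one_pow]
  generalize (h θ)⁻¹ = k' at *
  generalize h θ = k at *
  apply mul_left_cancel₀ (mul_ne_zero (mul_ne_zero hκ hq₀) hq)
  generalize ((Real.sqrt (Real.sinh (γ θ)) : ℝ) : ℂ) = t at *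
  generalize ((Real.exp (γ θ / 2) : ℝ) : ℂ) = a at *
  generalize ((Real.exp (-γ θ / 2) : ℝ) : ℂ) = a' at *
  generalize ((Real.exp (nufun N γ θ / 2) : ℝ) : ℂ) = η at *
  generalize ((Real.sin ((θ₀ + θ) / 2) : ℝ) : ℂ) = sn at *
  generalize ((Real.sinh X * Real.sinh Y : ℝ) : ℂ) = w at *
  generalize U.eval (Complex.exp (Complex.I * (-θ : ℝ))) = v at *
  linear_combination (-1 / 4 * k ^ 2 * t) * h1 -
    h θ₀ * w * S * q * q₀ * Complex.I * sn * (a' * k * v * k' * t * hinv' + a' * k * h3 +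
      κ * k * η * h10) + N * κ * q₀ * q * t * hinv2

end

theorem sin_half_ofReal_sub (a b : ℝ) :
    Complex.sin (((a : ℂ) - b) / 2) = (Real.sin ((a - b) / 2) : ℝ) := by
  push_cast
  rfl

theorem sin_half_ofReal_add (a b : ℝ) :
    Complex.sin (((a : ℂ) + b) / 2) = (Real.sin ((a + b) / 2) : ℝ) := by
  push_cast
  rfl

theorem sinh_mul_sinh_eq_one {x y : ℝ} (h : Real.tanh x = Real.exp (-(2 * y))) :
    Real.sinh (2 * y) * Real.sinh (2 * x) = 1 := by
  have hc := Real.cosh_pos x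
  rw [Real.tanh_eq_sinh_div_cosh, div_eq_iff hc.ne'] at h
  have h1 := Real.cosh_sq x
  have h2 : Real.exp (2 * y) * Real.exp (-(2 * y)) = 1 := by rw [← Real.exp_add]; simp
  rw [Real.sinh_two_mul x, Real.sinh_eq (2 * y)]
  rw [h] at h1 ⊢
  linear_combination Real.cosh x ^ 2 * h2 + h1

section

variable {X Y α β : ℝ} {γ : ℝ → ℝ} {N : ℕ}

theorem Dmat_apply (N : ℕ) (l : ℤ) (α β : ℝ) (j k : Fin N) :
    Dmat N l α β j k = Complex.exp (-Complex.I * ((l : ℂ) - 2⁻¹) * (thetaP N j - thetaA N k)) /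
        (2 * Complex.I * N * (Real.sin ((thetaA N k - thetaP N j) / 2) : ℝ)) *
      (sqb α β (thetaA N k) / sqb α β (thetaP N j) +
        sqb α β (thetaP N j) / sqb α β (thetaA N k)) := by
  rw [← sin_half_ofReal_sub]
  rfl

theorem Cmat_apply (N : ℕ) (l : ℤ) (α β : ℝ) (j k : Fin N) :
    Cmat N l α β j k = Complex.exp (-Complex.I * ((l : ℂ) - 2⁻¹) * (thetaP N j + thetaA N k)) /
        (2 * Complex.I * N * (Real.sin ((thetaP N j + thetaA N k) / 2) : ℝ)) *
      (sqb α β (thetaP N j) * sqb α β (thetaA N k) -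
        1 / (sqb α β (thetaP N j) * sqb α β (thetaA N k))) := by
  rw [← sin_half_ofReal_add]
  rfl

theorem exp_thetaP_injective (hN : N ≠ 0) :
    Function.Injective fun j : Fin N => Complex.exp (Complex.I * (thetaP N j : ℝ)) := by
  intro i j hij
  refine exp_angA_injective hN ?_
  have h (k : Fin N) : Complex.exp (Complex.I * (angA N k : ℝ)) =
      Complex.exp (Complex.I * (thetaP N k : ℝ)) * Complex.exp (Complex.I * (Real.pi / N : ℝ)) := by
    rw [← Complex.exp_add]
    congr 1
    unfold angA thetaP
    push_cast
    ring
  simp only at hij ⊢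
  rw [h, h, hij]

theorem det_Dmat_ne_zero (hN : N ≠ 0) (hγ : IsDispersion X Y γ)
    (hh : IsSymbRoot X Y γ (sqb α β)) (l : ℤ) : (Dmat N l α β).det ≠ 0 := by
  obtain ⟨U, V, κ, hI⟩ := exists_isInterpolant hγ hh (Nat.one_le_iff_ne_zero.2 hN)
  set S : Fin N → Fin N → ℂ := fun i j =>
    ∑ k : Fin N, pairWeight N γ (sqb α β) (thetaP N i) (thetaA N k) *
      (Real.sinh ((γ (thetaA N k) + γ (thetaP N j)) / 2) : ℝ) /
      ((Real.sin ((thetaA N k - thetaP N i) / 2) : ℝ) *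
        (Real.sin ((thetaA N k - thetaP N j) / 2) : ℝ)) with hS
  have hSne (i j : Fin N) (hij : i ≠ j) : S i j = 0 :=
    hI.sum_pairWeight_eq_zero hN hh hγ (exp_angP_pow hN i) (exp_angP_pow hN j)
      ((exp_thetaP_injective hN).ne hij.symm)
  have hSpos (i : Fin N) : S i i ≠ 0 := by
    choose r hr hre using fun k : Fin N => exists_pairWeight_eq hγ hh N (thetaP N i) (thetaA N k)
    have h1 : S i i = ((∑ k : Fin N, r k * Real.sinh ((γ (thetaA N k) + γ (thetaP N i)) / 2) /
        (Real.sin ((thetaA N k - thetaP N i) / 2) * Real.sin ((thetaA N k - thetaP N i) / 2)) :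
        ℝ) : ℂ) := by
      rw [Complex.ofReal_sum]
      refine sum_congr rfl fun k _ => ?_
      rw [hre, Complex.ofReal_div, Complex.ofReal_mul, Complex.ofReal_mul]
    rw [h1]
    have : Nonempty (Fin N) := ⟨i⟩
    refine Complex.ofReal_ne_zero.2 (sum_pos (fun k _ => ?_) univ_nonempty).ne'
    have h2 : Real.sin ((thetaA N k - thetaP N i) / 2) ≠ 0 := Complex.ofReal_ne_zero.1
      (sin_half_sub_angA_ne_zero hN (exp_angP_pow hN i) k)
    exact div_pos (mul_pos (hr k) (hγ.half_sinh_pos _ _)) (mul_self_pos.2 h2)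
  set M : Matrix (Fin N) (Fin N) ℂ := Matrix.of fun k j =>
    Complex.exp (-Complex.I * ((l : ℂ) - 2⁻¹) * (thetaA N k - thetaP N j)) *
      (Real.exp (nufun N γ (thetaA N k) / 2) : ℝ) / (Real.sqrt (Real.sinh (γ (thetaA N k))) : ℝ) *
      (Real.sinh ((γ (thetaA N k) + γ (thetaP N j)) / 2) : ℝ) /
      (Real.sin ((thetaA N k - thetaP N j) / 2) : ℝ) with hM
  have hDM : Dmat N l α β * M = Matrix.diagonal fun j => S j j / (2 * Complex.I * N) := by
    ext i j
    have h1 : (Dmat N l α β * M) i j =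
        Complex.exp (-Complex.I * ((l : ℂ) - 2⁻¹) * (thetaP N i - thetaP N j)) *
          (S i j / (2 * Complex.I * N)) := by
      rw [Matrix.mul_apply, hS]
      simp only
      rw [sum_div, mul_sum]
      refine sum_congr rfl fun k _ => ?_
      have h2 : Complex.exp (-Complex.I * ((l : ℂ) - 2⁻¹) * (thetaP N i - thetaP N j)) =
          Complex.exp (-Complex.I * ((l : ℂ) - 2⁻¹) * (thetaP N i - thetaA N k)) *
          Complex.exp (-Complex.I * ((l : ℂ) - 2⁻¹) * (thetaA N k - thetaP N j)) := by
        rw [← Complex.exp_add]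
        ring_nf
      rw [Dmat_apply, hM, Matrix.of_apply, h2, pairWeight]
      ring
    rw [h1]
    rcases eq_or_ne i j with rfl | hij
    · rw [Matrix.diagonal_apply_eq, sub_self, mul_zero, Complex.exp_zero, one_mul]
    · rw [hSne i j hij, Matrix.diagonal_apply_ne _ hij, zero_div, mul_zero]
  intro h0
  have h3 := congrArg Matrix.det hDM
  rw [Matrix.det_mul, h0, zero_mul, Matrix.det_diagonal] at h3
  have hNC : (N : ℂ) ≠ 0 := Nat.cast_ne_zero.2 hN
  exact (prod_ne_zero_iff.2 fun j _ => div_ne_zero (hSpos j)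
    (mul_ne_zero (mul_ne_zero two_ne_zero Complex.I_ne_zero) hNC)) h3.symm

theorem Dmat_mul_eq_Cmat (hN : N ≠ 0) (hγ : IsDispersion X Y γ)
    (hh : IsSymbRoot X Y γ (sqb α β)) (l : ℤ) :
    Dmat N l α β * (Matrix.of fun j k =>
      -Complex.I *
        Complex.exp (-Complex.I * ((l : ℂ) - 2⁻¹) * ((thetaA N j : ℝ) + (thetaA N k : ℝ))) *
        ((Real.sinh X * Real.sinh Y : ℝ) : ℂ) *
        ((Real.exp ((nufun N γ (thetaA N j) + nufun N γ (thetaA N k)) / 2) : ℝ) : ℂ) /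
        ((N : ℂ) *
          ((Real.sqrt (Real.sinh (γ (thetaA N j)) * Real.sinh (γ (thetaA N k))) : ℝ) : ℂ)) *
        Complex.sin ((((thetaA N j : ℝ) : ℂ) - (thetaA N k : ℝ)) / 2) /
        ((Real.sinh ((γ (thetaA N j) + γ (thetaA N k)) / 2) : ℝ) : ℂ)) = Cmat N l α β := by
  ext i j
  have hNC : (N : ℂ) ≠ 0 := Nat.cast_ne_zero.2 hN
  have hA' (k : Fin N) : angA N k = thetaA N k := rfl
  have hA := exp_angA_pow hN j
  have h1 := sum_pairWeight_mul_sin hN hh hγ (exp_angP_pow hN i) hA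
  have hs0 : ((Real.sqrt (Real.sinh (γ (thetaA N j))) : ℝ) : ℂ) ≠ 0 :=
    Complex.ofReal_ne_zero.2 (Real.sqrt_pos.2 (hγ.sinh_pos _)).ne'
  have hsn : ((Real.sin ((thetaP N i + thetaA N j) / 2) : ℝ) : ℂ) ≠ 0 := by
    have h2 := sin_half_sub_ne_zero (a := thetaP N i) (b := -thetaA N j) (fun h => by
      have h3 := congrArg (· ^ N) h
      simp only [Complex.ofReal_neg, mul_neg, Complex.exp_neg, inv_pow] at h3
      erw [hA, exp_angP_pow hN i] at h3
      norm_num at h3)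
    rwa [sub_neg_eq_add] at h2
  have hsum : (Dmat N l α β * (Matrix.of fun j k =>
      -Complex.I *
        Complex.exp (-Complex.I * ((l : ℂ) - 2⁻¹) * ((thetaA N j : ℝ) + (thetaA N k : ℝ))) *
        ((Real.sinh X * Real.sinh Y : ℝ) : ℂ) *
        ((Real.exp ((nufun N γ (thetaA N j) + nufun N γ (thetaA N k)) / 2) : ℝ) : ℂ) /
        ((N : ℂ) *
          ((Real.sqrt (Real.sinh (γ (thetaA N j)) * Real.sinh (γ (thetaA N k))) : ℝ) : ℂ)) *
        Complex.sin ((((thetaA N j : ℝ) : ℂ) - (thetaA N k : ℝ)) / 2) /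
        ((Real.sinh ((γ (thetaA N j) + γ (thetaA N k)) / 2) : ℝ) : ℂ))) i j =
      Complex.exp (-Complex.I * ((l : ℂ) - 2⁻¹) * (thetaP N i + thetaA N j)) *
        (-Complex.I * ((Real.sinh X * Real.sinh Y : ℝ) : ℂ) *
          (Real.exp (nufun N γ (thetaA N j) / 2) : ℝ) / (2 * Complex.I * N ^ 2 *
          (Real.sqrt (Real.sinh (γ (thetaA N j))) : ℝ)) *
        sinSum N γ (sqb α β) (thetaP N i) (-thetaA N j)) := by
    rw [Matrix.mul_apply, sinSum, mul_sum, mul_sum]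
    refine sum_congr rfl fun k _ => ?_
    have h2 : Complex.exp (-Complex.I * ((l : ℂ) - 2⁻¹) * (thetaP N i + thetaA N j)) =
        Complex.exp (-Complex.I * ((l : ℂ) - 2⁻¹) * (thetaP N i - thetaA N k)) *
        Complex.exp (-Complex.I * ((l : ℂ) - 2⁻¹) * (thetaA N k + thetaA N j)) := by
      rw [← Complex.exp_add]
      ring_nf
    rw [Dmat_apply, Matrix.of_apply, h2, pairWeight, Real.sqrt_mul (hγ.sinh_pos _).le, add_div,
      Real.exp_add, sin_half_ofReal_sub, hγ.neg, Complex.ofReal_mul (Real.sqrt _),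
      Complex.ofReal_mul (Real.exp _), ← sub_eq_add_neg]
    simp only [hA']
    ring
  rw [hsum, Cmat_apply]
  have hp := hh.ne_zero (thetaP N i)
  have ha := hh.ne_zero (thetaA N j)
  change sqb α β (thetaP N i) * sqb α β (thetaA N j) * _ *
    (Real.exp (nufun N γ (thetaA N j) / 2) : ℝ) * (Complex.I *
      (Real.sin ((thetaP N i + thetaA N j) / 2) : ℝ)) *
    sinSum N γ (sqb α β) (thetaP N i) (-thetaA N j) =
    N * (1 - sqb α β (thetaP N i) ^ 2 * sqb α β (thetaA N j) ^ 2) *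
      (Real.sqrt (Real.sinh (γ (thetaA N j))) : ℝ) at h1
  clear hsum
  generalize Complex.exp _ = E
  generalize sinSum N γ (sqb α β) (thetaP N i) (-thetaA N j) = S at *
  generalize ((Real.sqrt (Real.sinh (γ (thetaA N j))) : ℝ) : ℂ) = t at *
  generalize ((Real.sin ((thetaP N i + thetaA N j) / 2) : ℝ) : ℂ) = sn at *
  generalize ((Real.exp (nufun N γ (thetaA N j) / 2) : ℝ) : ℂ) = η at *
  generalize ((Real.sinh X * Real.sinh Y : ℝ) : ℂ) = w at *
  generalize sqb α β (thetaP N i) = p at *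
  generalize sqb α β (thetaA N j) = a at *
  have hI := Complex.I_ne_zero
  have key : -Complex.I * w * η / (2 * Complex.I * N ^ 2 * t) * S =
      1 / (2 * Complex.I * N * sn) * (p * a - 1 / (p * a)) := by
    rw [div_mul_eq_mul_div, one_div_mul_eq_div, div_eq_div_iff
      (by simp [*]) (by simp [*]), sub_div' (mul_ne_zero hp ha), div_mul_eq_mul_div,
      eq_div_iff (mul_ne_zero hp ha)]
    linear_combination (-2 * Complex.I * N) * h1
  rw [key]
  ring

end

theorem Dinv_C_formula
    (N : ℕ) (hN : 1 ≤ N) (l : ℤ) (Kx Ky Kxs : ℝ)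
    (hKx : 0 < Kx) (hKy : 0 < Ky)
    (hKxs_pos : 0 < Kxs) (hKxs : Real.tanh Kxs = Real.exp (-(2 * Kx)))
    (α β : ℝ)
    (hα : α = Real.tanh Kxs * (Real.cosh Ky / Real.sinh Ky))
    (hβ : β = Real.tanh Kxs * Real.tanh Ky)
    (hferro : Kxs < Ky)
    (γ : ℝ → ℝ) (hγ_nonneg : ∀ θ, 0 ≤ γ θ)
    (hγ : ∀ θ, Real.cosh (γ θ) =
      Real.cosh (2 * Kxs) * Real.cosh (2 * Ky) -
        Real.sinh (2 * Kxs) * Real.sinh (2 * Ky) * Real.cos θ) :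
    IsUnit (Dmat N l α β).det ∧
      ∀ j k : Fin N,
        ((Dmat N l α β)⁻¹ * Cmat N l α β) j k =
          -Complex.I *
              Complex.exp (-Complex.I * ((l : ℂ) - 2⁻¹) *
                ((thetaA N j : ℝ) + (thetaA N k : ℝ))) *
              ((Real.sinh (2 * Ky) / Real.sinh (2 * Kx) : ℝ) : ℂ) *
              ((Real.exp ((nufun N γ (thetaA N j) + nufun N γ (thetaA N k)) / 2) : ℝ) : ℂ) /
              ((N : ℂ) *
                ((Real.sqrt (Real.sinh (γ (thetaA N j)) * Real.sinh (γ (thetaA N k))) : ℝ) : ℂ)) *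
              Complex.sin ((((thetaA N j : ℝ) : ℂ) - (thetaA N k : ℝ)) / 2) /
              ((Real.sinh ((γ (thetaA N j) + γ (thetaA N k)) / 2) : ℝ) : ℂ) := by
  have hN' : N ≠ 0 := by omega
  have hdisp : IsDispersion (2 * Kxs) (2 * Ky) γ :=
    ⟨by positivity, by linarith, hγ_nonneg, hγ⟩
  have hroot := isSymbRoot_sqb hdisp hα hβ
  have hdet : IsUnit (Dmat N l α β).det := (det_Dmat_ne_zero hN' hdisp hroot l).isUnit
  refine ⟨hdet, fun j k => ?_⟩
  have hX : Real.sinh (2 * Kx) ≠ 0 := (Real.sinh_pos_iff.2 (by positivity)).ne'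
  have hw : Real.sinh (2 * Ky) / Real.sinh (2 * Kx) =
      Real.sinh (2 * Kxs) * Real.sinh (2 * Ky) := by
    rw [div_eq_iff hX]
    linear_combination (-Real.sinh (2 * Ky)) * sinh_mul_sinh_eq_one hKxs
  rw [← Dmat_mul_eq_Cmat hN' hdisp hroot l, Matrix.nonsing_inv_mul_cancel_left _ _ hdet, hw,
    Matrix.of_apply]
end
end

section
/- (Frobenius determinant formula.) Let N ≥ 1, let x_1,…,x_N, y_1,…,y_N, α ∈ ℂ, and let τ ∈ ℂ with Im τ > 0. Assume θ1(α;τ) ≠ 0 and θ1(x_i − y_j;τ) ≠ 0 for all i,j. Then the N×N elliptic Cauchy matrix Ṽ with entries Ṽ_{ij} = θ1(x_i − y_j + α;τ)/(θ1(x_i − y_j;τ)·θ1(α;τ)) satisfies det Ṽ = [θ1(∑_{i=1}^N x_i − ∑_{i=1}^N y_i + α;τ)/θ1(α;τ)] · [∏_{1≤i<j≤N} θ1(x_i − x_j;τ)·θ1(y_j − y_i;τ)] / [∏_{i,j=1}^N θ1(x_i − y_j;τ)]. -/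
open Finset

noncomputable section

/-- The Jacobi theta function
`θ1(z;τ) = −i ∑_{n∈ℤ} (−1)^n exp(iπτ(n+1/2)²)·e^{(2n+1)iz}`. -/
def jacobiTheta1 (z τ : ℂ) : ℂ :=
  -Complex.I * ∑' n : ℤ,
    (-1 : ℂ) ^ n *
      Complex.exp ((Real.pi : ℂ) * Complex.I * τ * ((n : ℂ) + 2⁻¹) ^ 2) *
      Complex.exp ((2 * (n : ℂ) + 1) * Complex.I * z)

/-- Theta series over the even integers, with nome `exp (iπτ/2)`. -/
def thetaEven (z τ : ℂ) : ℂ :=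
  ∑' n : ℤ, Complex.exp (Real.pi * Complex.I * τ * (2 * (n : ℂ) ^ 2) + 4 * n * Complex.I * z)

/-- Theta series over the odd integers, with nome `exp (iπτ/2)`. -/
def thetaOdd (z τ : ℂ) : ℂ :=
  ∑' n : ℤ, Complex.exp (Real.pi * Complex.I * τ * (2 * (n : ℂ) ^ 2 + 2 * n + 2⁻¹) +
    2 * (2 * n + 1) * Complex.I * z)

theorem jacobiTheta1_term_eq (n : ℤ) (z τ : ℂ) :
    (-1 : ℂ) ^ n * Complex.exp ((Real.pi : ℂ) * Complex.I * τ * ((n : ℂ) + 2⁻¹) ^ 2) *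
      Complex.exp ((2 * (n : ℂ) + 1) * Complex.I * z) =
    Complex.exp (Real.pi * Complex.I * τ / 4 + Complex.I * z) *
      jacobiTheta₂_term n (z / Real.pi + τ / 2 + 1 / 2) τ := by
  have hpi : (Real.pi : ℂ) ≠ 0 := by exact_mod_cast Real.pi_ne_zero
  rw [← Complex.exp_pi_mul_I, ← Complex.exp_int_mul, jacobiTheta₂_term, ← Complex.exp_add,
    ← Complex.exp_add, ← Complex.exp_add]
  congr 1
  field_simp
  ring

theorem summable_jacobiTheta1_term (z : ℂ) {τ : ℂ} (hτ : 0 < τ.im) :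
    Summable fun n : ℤ => (-1 : ℂ) ^ n *
      Complex.exp ((Real.pi : ℂ) * Complex.I * τ * ((n : ℂ) + 2⁻¹) ^ 2) *
      Complex.exp ((2 * (n : ℂ) + 1) * Complex.I * z) := by
  simp_rw [jacobiTheta1_term_eq]
  exact ((summable_jacobiTheta₂_term_iff _ _).2 hτ).mul_left _

theorem jacobiTheta1_eq_jacobiTheta₂ (z τ : ℂ) :
    jacobiTheta1 z τ = -Complex.I * (Complex.exp (Real.pi * Complex.I * τ / 4 + Complex.I * z) *
      jacobiTheta₂ (z / Real.pi + τ / 2 + 1 / 2) τ) := by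
  simp_rw [jacobiTheta1, jacobiTheta1_term_eq, tsum_mul_left, jacobiTheta₂]

theorem differentiable_jacobiTheta1 {τ : ℂ} (hτ : 0 < τ.im) :
    Differentiable ℂ fun z => jacobiTheta1 z τ := by
  simp_rw [jacobiTheta1_eq_jacobiTheta₂]
  have h : Differentiable ℂ fun z => jacobiTheta₂ z τ :=
    fun z => differentiableAt_jacobiTheta₂_fst z hτ
  have h' : Differentiable ℂ fun z : ℂ => jacobiTheta₂ (z / Real.pi + τ / 2 + 1 / 2) τ :=
    h.comp (by fun_prop : Differentiable ℂ fun z : ℂ => z / Real.pi + τ / 2 + 1 / 2)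
  fun_prop

theorem summable_thetaEven_term (z : ℂ) {τ : ℂ} (hτ : 0 < τ.im) :
    Summable fun n : ℤ => Complex.exp
      (Real.pi * Complex.I * τ * (2 * (n : ℂ) ^ 2) + 4 * n * Complex.I * z) := by
  have hpi : (Real.pi : ℂ) ≠ 0 := by exact_mod_cast Real.pi_ne_zero
  refine ((summable_jacobiTheta₂_term_iff (2 * z / Real.pi) (2 * τ)).2 (by simpa using hτ)).congr
    fun n => ?_
  rw [jacobiTheta₂_term]
  congr 1
  field_simp
  ring

theorem summable_thetaOdd_term (z : ℂ) {τ : ℂ} (hτ : 0 < τ.im) :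
    Summable fun n : ℤ => Complex.exp
      (Real.pi * Complex.I * τ * (2 * (n : ℂ) ^ 2 + 2 * n + 2⁻¹) +
        2 * (2 * n + 1) * Complex.I * z) := by
  have hpi : (Real.pi : ℂ) ≠ 0 := by exact_mod_cast Real.pi_ne_zero
  refine (((summable_jacobiTheta₂_term_iff (2 * z / Real.pi + τ) (2 * τ)).2
    (by simpa using hτ)).mul_left
      (Complex.exp (Real.pi * Complex.I * τ / 2 + 2 * Complex.I * z))).congr fun n => ?_
  rw [jacobiTheta₂_term, ← Complex.exp_add]
  congr 1
  field_simp
  ring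

/-- Pairs of integers, split according to the parity of their sum. -/
def intProdParityEquiv : (ℤ × ℤ) ⊕ (ℤ × ℤ) ≃ ℤ × ℤ :=
  Equiv.ofBijective
    (Sum.elim (fun p => (p.1 + p.2, p.1 - p.2 - 1)) (fun p => (p.1 + p.2, p.1 - p.2))) (by
      constructor
      · rintro (⟨j, l⟩ | ⟨j, l⟩) (⟨j', l'⟩ | ⟨j', l'⟩) h <;>
          simp only [Sum.elim_inl, Sum.elim_inr, Prod.mk.injEq] at h
        · obtain rfl : j = j' := by omega
          obtain rfl : l = l' := by omega
          rfl
        · omega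
        · omega
        · obtain rfl : j = j' := by omega
          obtain rfl : l = l' := by omega
          rfl
      · rintro ⟨m, n⟩
        rcases Int.even_or_odd' (m + n) with ⟨k, hk | hk⟩
        · refine ⟨Sum.inr (k, m - k), ?_⟩
          simp only [Sum.elim_inr, Prod.mk.injEq]
          omega
        · refine ⟨Sum.inl (k + 1, m - k - 1), ?_⟩
          simp only [Sum.elim_inl, Prod.mk.injEq]
          omega)

theorem tsum_mul_tsum_eq_of_int_parity {f g e o e' o' : ℤ → ℂ} (hf : Summable f)
    (hg : Summable g) (he : Summable e) (ho : Summable o) (he' : Summable e') (ho' : Summable o')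
    (h_odd : ∀ j l, f (j + l) * g (j - l - 1) = -(e j * o' l))
    (h_even : ∀ j l, f (j + l) * g (j - l) = o j * e' l) :
    (∑' n, f n) * ∑' n, g n = -((∑' n, e n) * ∑' n, o' n) + (∑' n, o n) * ∑' n, e' n := by
  have hl := hf.hasSum.mul hg.hasSum (summable_mul_of_summable_norm hf.norm hg.norm)
  have h₁ := (he.hasSum.mul ho'.hasSum (summable_mul_of_summable_norm he.norm ho'.norm)).neg
  have h₂ := ho.hasSum.mul he'.hasSum (summable_mul_of_summable_norm ho.norm he'.norm)
  simp only [← h_odd] at h₁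
  simp only [← h_even] at h₂
  exact (intProdParityEquiv.hasSum_iff.2 hl).unique (HasSum.sum h₁ h₂)

theorem jacobiTheta1_term_mul_of_odd (j l : ℤ) (u v τ : ℂ) :
    ((-1 : ℂ) ^ (j + l) *
      Complex.exp ((Real.pi : ℂ) * Complex.I * τ * (((j + l : ℤ) : ℂ) + 2⁻¹) ^ 2) *
      Complex.exp ((2 * ((j + l : ℤ) : ℂ) + 1) * Complex.I * (u + v))) *
    ((-1 : ℂ) ^ (j - l - 1) *
      Complex.exp ((Real.pi : ℂ) * Complex.I * τ * (((j - l - 1 : ℤ) : ℂ) + 2⁻¹) ^ 2) *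
      Complex.exp ((2 * ((j - l - 1 : ℤ) : ℂ) + 1) * Complex.I * (u - v))) =
    -(Complex.exp (Real.pi * Complex.I * τ * (2 * (j : ℂ) ^ 2) + 4 * j * Complex.I * u) *
      Complex.exp (Real.pi * Complex.I * τ * (2 * (l : ℂ) ^ 2 + 2 * l + 2⁻¹) +
        2 * (2 * l + 1) * Complex.I * v)) := by
  have hsgn : (-1 : ℂ) ^ (j + l) * (-1 : ℂ) ^ (j - l - 1) = -1 := by
    rw [← zpow_add₀ (by norm_num)]
    exact Odd.neg_one_zpow ⟨j - 1, by ring⟩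
  rw [mul_assoc ((-1 : ℂ) ^ (j + l)), mul_assoc ((-1 : ℂ) ^ (j - l - 1)), mul_mul_mul_comm, hsgn,
    neg_one_mul, ← Complex.exp_add,
    ← Complex.exp_add, ← Complex.exp_add, ← Complex.exp_add]
  congr 2
  push_cast
  ring

theorem jacobiTheta1_term_mul_of_even (j l : ℤ) (u v τ : ℂ) :
    ((-1 : ℂ) ^ (j + l) *
      Complex.exp ((Real.pi : ℂ) * Complex.I * τ * (((j + l : ℤ) : ℂ) + 2⁻¹) ^ 2) *
      Complex.exp ((2 * ((j + l : ℤ) : ℂ) + 1) * Complex.I * (u + v))) *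
    ((-1 : ℂ) ^ (j - l) *
      Complex.exp ((Real.pi : ℂ) * Complex.I * τ * (((j - l : ℤ) : ℂ) + 2⁻¹) ^ 2) *
      Complex.exp ((2 * ((j - l : ℤ) : ℂ) + 1) * Complex.I * (u - v))) =
    Complex.exp (Real.pi * Complex.I * τ * (2 * (j : ℂ) ^ 2 + 2 * j + 2⁻¹) +
        2 * (2 * j + 1) * Complex.I * u) *
      Complex.exp (Real.pi * Complex.I * τ * (2 * (l : ℂ) ^ 2) + 4 * l * Complex.I * v) := by
  have hsgn : (-1 : ℂ) ^ (j + l) * (-1 : ℂ) ^ (j - l) = 1 := by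
    rw [← zpow_add₀ (by norm_num)]
    exact Even.neg_one_zpow ⟨j, by ring⟩
  rw [mul_assoc ((-1 : ℂ) ^ (j + l)), mul_assoc ((-1 : ℂ) ^ (j - l)), mul_mul_mul_comm, hsgn,
    one_mul, ← Complex.exp_add,
    ← Complex.exp_add, ← Complex.exp_add, ← Complex.exp_add]
  congr 1
  push_cast
  ring

theorem jacobiTheta1_add_mul_jacobiTheta1_sub (u v : ℂ) {τ : ℂ} (hτ : 0 < τ.im) :
    jacobiTheta1 (u + v) τ * jacobiTheta1 (u - v) τ =
      thetaEven u τ * thetaOdd v τ - thetaOdd u τ * thetaEven v τ := by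
  have key := tsum_mul_tsum_eq_of_int_parity (summable_jacobiTheta1_term (u + v) hτ)
    (summable_jacobiTheta1_term (u - v) hτ) (summable_thetaEven_term u hτ)
    (summable_thetaOdd_term u hτ) (summable_thetaEven_term v hτ) (summable_thetaOdd_term v hτ)
    (fun j l => jacobiTheta1_term_mul_of_odd j l u v τ)
    (fun j l => jacobiTheta1_term_mul_of_even j l u v τ)
  rw [jacobiTheta1, jacobiTheta1, mul_mul_mul_comm, key, thetaEven, thetaEven, thetaOdd, thetaOdd,
    neg_mul_neg, Complex.I_mul_I]
  ring

/-- The Weierstrass three-term identity, in the form of the `2 × 2` Frobenius determinant. -/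
theorem jacobiTheta1_three_term (x₁ x₂ y₁ y₂ a : ℂ) {τ : ℂ} (hτ : 0 < τ.im) :
    jacobiTheta1 (x₁ - y₁ + a) τ * jacobiTheta1 (x₂ - y₂ + a) τ *
        (jacobiTheta1 (x₁ - y₂) τ * jacobiTheta1 (x₂ - y₁) τ) -
      jacobiTheta1 (x₁ - y₂ + a) τ * jacobiTheta1 (x₂ - y₁ + a) τ *
        (jacobiTheta1 (x₁ - y₁) τ * jacobiTheta1 (x₂ - y₂) τ) =
    jacobiTheta1 (x₁ + x₂ - y₁ - y₂ + a) τ * jacobiTheta1 a τ *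
      (jacobiTheta1 (x₁ - x₂) τ * jacobiTheta1 (y₂ - y₁) τ) := by
  have H : ∀ p q : ℂ, jacobiTheta1 p τ * jacobiTheta1 q τ =
      thetaEven ((p + q) / 2) τ * thetaOdd ((p - q) / 2) τ -
        thetaOdd ((p + q) / 2) τ * thetaEven ((p - q) / 2) τ := fun p q => by
    rw [← jacobiTheta1_add_mul_jacobiTheta1_sub _ _ hτ]
    ring_nf
  simp only [H]
  ring_nf

/-- Two entire functions that agree off the zero set of a nonzero entire function are equal. -/
theorem eq_of_eq_off_zeros {h f g : ℂ → ℂ} (hh : Differentiable ℂ h) {z : ℂ} (hz : h z ≠ 0)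
    (hf : Differentiable ℂ f) (hg : Differentiable ℂ g) (heq : ∀ w, h w ≠ 0 → f w = g w) :
    f = g := by
  have hF := Complex.analyticOnNhd_univ_iff_differentiable.2 hh
  have hG := Complex.analyticOnNhd_univ_iff_differentiable.2 (hf.sub hg)
  rcases AnalyticOnNhd.eq_zero_or_eq_zero_of_mul_eq_zero hF hG (fun w _ => by
    by_cases hw : h w = 0
    · rw [hw, zero_mul]
    · rw [Pi.sub_apply, heq w hw, sub_self, mul_zero]) isPreconnected_univ with H | H
  · exact absurd (H z (Set.mem_univ _)) hz
  · exact funext fun w => sub_eq_zero.1 (H w (Set.mem_univ _))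

/-- One step of the Frobenius determinant formula, by pivoting on the top left entry: for a function
satisfying the three-term identity, the Schur complement is again an elliptic Cauchy matrix up to
scaling of rows and columns. -/
theorem det_div_succ_of_three_term (θ : ℂ → ℂ)
    (hθ : ∀ x₁ x₂ y₁ y₂ a : ℂ,
      θ (x₁ - y₁ + a) * θ (x₂ - y₂ + a) * (θ (x₁ - y₂) * θ (x₂ - y₁)) -
        θ (x₁ - y₂ + a) * θ (x₂ - y₁ + a) * (θ (x₁ - y₁) * θ (x₂ - y₂)) =
      θ (x₁ + x₂ - y₁ - y₂ + a) * θ a * (θ (x₁ - x₂) * θ (y₂ - y₁)))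
    (n : ℕ) (x y : Fin (n + 2) → ℂ) (a b : ℂ) (hbdef : b = x 0 - y 0 + a)
    (hxy : ∀ i j, θ (x i - y j) ≠ 0) (hb : θ b ≠ 0)
    (hS : (Matrix.of fun i j : Fin (n + 1) =>
        θ (x i.succ - y j.succ + b) / θ (x i.succ - y j.succ)).det =
      θ b ^ n * θ ((∑ i : Fin (n + 1), x i.succ) - (∑ i : Fin (n + 1), y i.succ) + b) *
        (∏ i : Fin (n + 1), ∏ j ∈ univ.filter (fun j => i < j),
          θ (x i.succ - x j.succ) * θ (y j.succ - y i.succ)) /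
        ∏ i : Fin (n + 1), ∏ j : Fin (n + 1), θ (x i.succ - y j.succ)) :
    (Matrix.of fun i j => θ (x i - y j + a) / θ (x i - y j)).det =
      θ a ^ (n + 1) * θ ((∑ i, x i) - (∑ i, y i) + a) *
        (∏ i, ∏ j ∈ univ.filter (fun j => i < j), θ (x i - x j) * θ (y j - y i)) /
        ∏ i, ∏ j, θ (x i - y j) := by
  let A : Matrix (Fin (n + 2)) (Fin (n + 2)) ℂ :=
    Matrix.of fun i j => θ (x i - y j + a) / θ (x i - y j)
  let B : Matrix (Fin (n + 2)) (Fin (n + 2)) ℂ :=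
    Matrix.of fun i j => if i = 0 then A 0 j else A i j - A i 0 / A 0 0 * A 0 j
  have hA : ∀ i j, A i j = θ (x i - y j + a) / θ (x i - y j) := fun _ _ => rfl
  have hA0 : A 0 0 ≠ 0 := div_ne_zero (hbdef ▸ hb) (hxy 0 0)
  have hAB : A.det = B.det := by
    refine Matrix.det_eq_of_forall_row_eq_smul_add_const
      (fun i => if i = 0 then 0 else A i 0 / A 0 0) 0 (if_pos rfl) fun i j => ?_
    by_cases hi : i = 0 <;> simp [B, hi]
  have hB : B.det = A 0 0 * (B.submatrix Fin.succ Fin.succ).det := by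
    rw [Matrix.det_succ_column_zero, Fin.sum_univ_succ, Finset.sum_eq_zero]
    · simp [B]
    · intro i _
      simp [B, hA0]
  have hsub : B.submatrix Fin.succ Fin.succ = Matrix.of fun i j : Fin (n + 1) =>
      (θ a / θ b * (θ (x 0 - x i.succ) / θ (x i.succ - y 0))) *
        (Matrix.of fun i j : Fin (n + 1) => (θ (y j.succ - y 0) / θ (x 0 - y j.succ)) *
          (Matrix.of fun i j : Fin (n + 1) =>
            θ (x i.succ - y j.succ + b) / θ (x i.succ - y j.succ)) i j) i j := by
    ext i j
    have h3 := hθ (x 0) (x i.succ) (y 0) (y j.succ) a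
    rw [show x 0 + x i.succ - y 0 - y j.succ + a = x i.succ - y j.succ + b by
      rw [hbdef]; ring] at h3
    have e1 := hxy 0 0
    have e2 := hxy i.succ 0
    have e3 := hxy 0 j.succ
    have e4 := hxy i.succ j.succ
    simp only [B, hA, Matrix.submatrix_apply, Matrix.of_apply, Fin.succ_ne_zero, if_false]
    rw [← hbdef] at h3 ⊢
    field_simp
    linear_combination h3
  have hsum : (∑ i, x i) - (∑ i, y i) + a =
      (∑ i : Fin (n + 1), x i.succ) - (∑ i : Fin (n + 1), y i.succ) + b := by
    rw [Fin.sum_univ_succ x, Fin.sum_univ_succ y, hbdef]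
    ring
  have hprod : (∏ i, ∏ j ∈ univ.filter (fun j => i < j), θ (x i - x j) * θ (y j - y i)) =
      ((∏ i : Fin (n + 1), θ (x 0 - x i.succ)) * ∏ j : Fin (n + 1), θ (y j.succ - y 0)) *
      ∏ i : Fin (n + 1), ∏ j ∈ univ.filter (fun j => i < j),
        θ (x i.succ - x j.succ) * θ (y j.succ - y i.succ) := by
    simp only [Finset.prod_filter]
    rw [Fin.prod_univ_succ]
    simp [Fin.prod_univ_succ (n := n + 1), Finset.prod_mul_distrib]
  have hden : (∏ i, ∏ j, θ (x i - y j)) =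
      (θ (x 0 - y 0) * (∏ j : Fin (n + 1), θ (x 0 - y j.succ)) *
        ∏ i : Fin (n + 1), θ (x i.succ - y 0)) *
        ∏ i : Fin (n + 1), ∏ j : Fin (n + 1), θ (x i.succ - y j.succ) := by
    rw [Fin.prod_univ_succ, Fin.prod_univ_succ]
    simp only [Fin.prod_univ_succ (n := n + 1), Finset.prod_mul_distrib]
    ring
  change A.det = _
  rw [hAB, hB, hsub, Matrix.det_mul_column, Matrix.det_mul_row, hS, hsum, hprod, hden, hA,
    ← hbdef]
  simp only [Finset.prod_mul_distrib, Finset.prod_div_distrib, Finset.prod_const, Finset.card_univ,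
    Fintype.card_fin]
  have p4 := hxy 0 0
  field_simp
  ring

/-- The Frobenius determinant formula with the common factor `θ1(a)⁻¹` of the entries removed;
it needs no assumption on `a`. -/
theorem det_jacobiTheta1_div {τ : ℂ} (hτ : 0 < τ.im) (n : ℕ) (x y : Fin (n + 1) → ℂ) (a : ℂ)
    (hxy : ∀ i j, jacobiTheta1 (x i - y j) τ ≠ 0) :
    (Matrix.of fun i j => jacobiTheta1 (x i - y j + a) τ / jacobiTheta1 (x i - y j) τ).det =
      jacobiTheta1 a τ ^ n * jacobiTheta1 ((∑ i, x i) - (∑ i, y i) + a) τ *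
        (∏ i, ∏ j ∈ univ.filter (fun j => i < j),
          jacobiTheta1 (x i - x j) τ * jacobiTheta1 (y j - y i) τ) /
        ∏ i, ∏ j, jacobiTheta1 (x i - y j) τ := by
  induction n generalizing a with
  | zero => simp [Finset.filter_singleton]
  | succ n ih =>
    have hd := differentiable_jacobiTheta1 hτ
    have hshift : ∀ c : ℂ, Differentiable ℂ fun b => jacobiTheta1 (c + b) τ := fun c =>
      hd.comp (by fun_prop : Differentiable ℂ fun b : ℂ => c + b)
    have hdet : Differentiable ℂ fun b => (Matrix.of fun i j =>
        jacobiTheta1 (x i - y j + b) τ / jacobiTheta1 (x i - y j) τ).det := by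
      simp only [Matrix.det_apply', Matrix.of_apply]
      exact Differentiable.fun_sum fun σ _ => (Differentiable.fun_finsetProd fun i _ =>
        (hshift _).div_const _).const_mul _
    have hrhs : ∀ c P Q : ℂ, Differentiable ℂ fun b =>
        jacobiTheta1 b τ ^ (n + 1) * jacobiTheta1 (c + b) τ * P / Q := fun c P Q =>
      (((hd.pow (n + 1)).mul (hshift c)).mul_const P).div_const Q
    refine congrFun (eq_of_eq_off_zeros (hshift (x 0 - y 0)) (z := 0) (by simpa using hxy 0 0) hdet
      (hrhs _ _ _) fun b hb => ?_) a
    exact det_div_succ_of_three_term (fun z => jacobiTheta1 z τ)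
      (fun x₁ x₂ y₁ y₂ a => jacobiTheta1_three_term x₁ x₂ y₁ y₂ a hτ) n x y b _ rfl hxy hb
      (ih (fun i => x i.succ) (fun j => y j.succ) _ fun i j => hxy _ _)

/-- Frobenius determinant formula for the elliptic Cauchy matrix. -/
theorem frobenius_det
    (N : ℕ) (hN : 1 ≤ N) (x y : Fin N → ℂ) (a τ : ℂ) (hτ : 0 < τ.im)
    (ha : jacobiTheta1 a τ ≠ 0)
    (hxy : ∀ i j, jacobiTheta1 (x i - y j) τ ≠ 0) :
    (Matrix.of fun i j : Fin N =>
        jacobiTheta1 (x i - y j + a) τ /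
          (jacobiTheta1 (x i - y j) τ * jacobiTheta1 a τ)).det =
      jacobiTheta1 ((∑ i, x i) - (∑ i, y i) + a) τ / jacobiTheta1 a τ *
        (∏ i : Fin N, ∏ j ∈ univ.filter (fun j => i < j),
          jacobiTheta1 (x i - x j) τ * jacobiTheta1 (y j - y i) τ) /
        ∏ i : Fin N, ∏ j : Fin N, jacobiTheta1 (x i - y j) τ := by
  obtain ⟨n, rfl⟩ : ∃ n, N = n + 1 := ⟨N - 1, by omega⟩
  have hM : (Matrix.of fun i j : Fin (n + 1) => jacobiTheta1 (x i - y j + a) τ /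
      (jacobiTheta1 (x i - y j) τ * jacobiTheta1 a τ)) =
      (jacobiTheta1 a τ)⁻¹ • Matrix.of fun i j : Fin (n + 1) =>
        jacobiTheta1 (x i - y j + a) τ / jacobiTheta1 (x i - y j) τ := by
    ext i j
    have := hxy i j
    simp only [Matrix.of_apply, Matrix.smul_apply, smul_eq_mul]
    field_simp
  rw [hM, Matrix.det_smul, det_jacobiTheta1_div hτ n x y a hxy, Fintype.card_fin, pow_succ,
    inv_pow]
  field_simp
end
end
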